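/- arXiv:1210.5736 — 3 statements merged into one kernel-verified Lean document; each statement's English description precedes it below -/
import Mathlib

section
/- For every integer d ≥ 3 and every real ε > 0 there exists m₀ such that for all integers m ≥ m₀, the number g_d(m) of isomorphism classes of groups of order 2^m which admit a generating set consisting of d involutions satisfies g_d(m) ≤ 2^{((d−2)/2 + ε)·m²}. -/
/-- A group of order `2^m` together with a generating set consisting of `d` involutions. -/
structure InvolGenGroup (d m : ℕ) : Type 1 where
  G : Type
  [grp : Group G]
  card_eq : Nat.card G = 2 ^ m
  S : Finset G
  card_S : S.card = d
  invol : ∀ x ∈ S, orderOf x = 2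
  gen : Subgroup.closure (S : Set G) = ⊤

attribute [instance] InvolGenGroup.grp

/-- Such groups, up to group isomorphism. -/
def involGenSetoid (d m : ℕ) : Setoid (InvolGenGroup d m) where
  r a b := Nonempty (a.G ≃* b.G)
  iseqv := ⟨fun _ => ⟨MulEquiv.refl _⟩, fun ⟨e⟩ => ⟨e.symm⟩, fun ⟨e⟩ ⟨f⟩ => ⟨e.trans f⟩⟩

/-- `g_d(m)`: the number of isomorphism classes of groups of order `2^m` which admit a
generating set consisting of `d` involutions. -/
noncomputable def gCount (d m : ℕ) : ℕ := Nat.card (Quotient (involGenSetoid d m))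

section LinearAlgebra

open Module

variable {K V : Type*} [Field K] [AddCommGroup V] [Module K V] [FiniteDimensional K V]

theorem Submodule.finrank_iSup_le_sum_finrank {ι : Type*} [Fintype ι] (P : ι → Submodule K V) :
    finrank K ↥(⨆ i, P i) ≤ ∑ i, finrank K (P i) := by
  classical
  rw [← Finset.sup_univ_eq_iSup]
  induction (Finset.univ : Finset ι) using Finset.induction_on with
  | empty => simp
  | insert a s ha ih =>
    rw [Finset.sup_insert, Finset.sum_insert ha]
    exact (Submodule.finrank_add_le_finrank_add_finrank _ _).trans (by omega)

theorem Submodule.finrank_map_add_finrank_inf_ker {V' : Type*} [AddCommGroup V'] [Module K V']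
    (f : V →ₗ[K] V') (P : Submodule K V) :
    finrank K (P.map f) + finrank K ↥(P ⊓ f.ker) = finrank K P := by
  have h := (f.domRestrict P).finrank_range_add_finrank_ker
  rwa [LinearMap.range_domRestrict, LinearMap.ker_domRestrict,
    (Submodule.equivSubtypeMap P (f.ker.comap P.subtype)).finrank_eq,
    Submodule.map_comap_subtype] at h

theorem Submodule.finrank_map_mkQ_add_finrank_inf (P B : Submodule K V) :
    finrank K (P.map B.mkQ) + finrank K ↥(B ⊓ P) = finrank K P := by
  have h := P.finrank_map_add_finrank_inf_ker B.mkQ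
  rwa [Submodule.ker_mkQ, inf_comm P B] at h

theorem Submodule.finrank_map_mkQ_add_finrank {P B : Submodule K V} (h : B ≤ P) :
    finrank K (P.map B.mkQ) + finrank K B = finrank K P := by
  have := P.finrank_map_mkQ_add_finrank_inf B
  rwa [inf_eq_left.2 h] at this

theorem Submodule.finrank_map_mkQ_le {ι : Type*} [Fintype ι] {S W B : Submodule K V}
    {P : ι → Submodule K V} (h : S ≤ W ⊔ (⨆ i, P i) ⊔ B) :
    finrank K (S.map B.mkQ) ≤ finrank K W + ∑ i, finrank K ((P i).map B.mkQ) := by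
  have h1 : S.map B.mkQ ≤ W.map B.mkQ ⊔ ⨆ i, (P i).map B.mkQ := by
    refine (Submodule.map_mono h).trans ?_
    rw [Submodule.map_sup, Submodule.map_sup, Submodule.map_iSup, Submodule.mkQ_map_self,
      sup_bot_eq]
  refine (Submodule.finrank_mono h1).trans
    ((Submodule.finrank_add_le_finrank_add_finrank _ _).trans ?_)
  exact add_le_add (Submodule.finrank_map_le _ _) (Submodule.finrank_iSup_le_sum_finrank _)

/-- If the operators `x l` act with square zero on `S / S'`, kill `Z`, and their images generate
`S / S'` together with `W`, then `S / S'` is small relative to its quotient by the image of `Z`. -/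
theorem finrank_layer_le {ι : Type*} [Fintype ι] (x : ι → V →ₗ[K] V) {S S' Z W : Submodule K V}
    (hS' : S' ≤ S) (hxS : ∀ l, S.map (x l) ≤ S) (hxS' : ∀ l, S'.map (x l) ≤ S')
    (hxx : ∀ l, (S.map (x l)).map (x l) ≤ S') (hZ : ∀ l, Z ≤ (x l).ker)
    (hgen : S ≤ W ⊔ (⨆ l, S.map (x l)) ⊔ S') :
    (finrank K S : ℤ) - finrank K S' ≤ ((Fintype.card ι : ℤ) - 1) *
      ((finrank K (S.map Z.mkQ) : ℤ) - finrank K (S'.map Z.mkQ)) + 2 * finrank K W := by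
  set B := S' ⊔ (Z ⊓ S) with hB
  have hBS : B ≤ S := sup_le hS' inf_le_right
  have hdimB : (finrank K S : ℤ) - finrank K B =
      (finrank K (S.map Z.mkQ) : ℤ) - finrank K (S'.map Z.mkQ) := by
    have h1 := Submodule.finrank_sup_add_finrank_inf_eq S' (Z ⊓ S)
    have h2 : S' ⊓ (Z ⊓ S) = Z ⊓ S' := by
      rw [inf_left_comm, inf_eq_left.2 hS']
    rw [h2, ← hB] at h1
    have h3 := S.finrank_map_mkQ_add_finrank_inf Z
    have h4 := S'.finrank_map_mkQ_add_finrank_inf Z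
    omega
  have hrank : ∀ l, (finrank K ((S.map (x l)).map S'.mkQ) : ℤ) ≤
      (finrank K S : ℤ) - finrank K B - finrank K ((S.map (x l)).map B.mkQ) := by
    intro l
    have h1 := S.finrank_map_add_finrank_inf_ker (S'.mkQ ∘ₗ x l)
    rw [Submodule.map_comp] at h1
    have h2 : B ⊔ S.map (x l) ≤ S ⊓ (S'.mkQ ∘ₗ x l).ker := by
      rw [LinearMap.ker_comp, Submodule.ker_mkQ]
      refine le_inf (sup_le hBS (hxS l)) (sup_le (sup_le ?_ ?_) ?_)
      · exact Submodule.map_le_iff_le_comap.1 (hxS' l)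
      · intro v hv
        have : x l v = 0 := hZ l hv.1
        simp [this]
      · exact Submodule.map_le_iff_le_comap.1 (hxx l)
    have h3 := Submodule.finrank_mono h2
    have h4 := Submodule.finrank_map_mkQ_add_finrank (le_sup_left : B ≤ B ⊔ S.map (x l))
    rw [Submodule.map_sup, Submodule.mkQ_map_self, bot_sup_eq] at h4
    omega
  have h1 := Submodule.finrank_map_mkQ_le hgen
  have h2 := Submodule.finrank_map_mkQ_add_finrank hS'
  have h3 := Submodule.finrank_map_mkQ_le (hgen.trans (sup_le_sup_left (le_sup_left : S' ≤ B) _))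
  have h4 := Submodule.finrank_map_mkQ_add_finrank hBS
  have h5 := Finset.sum_le_sum fun l (_ : l ∈ Finset.univ) => hrank l
  rw [Finset.sum_sub_distrib, Finset.sum_const, Finset.card_univ, nsmul_eq_mul, hdimB] at h5
  zify at h1 h2 h3 h4
  linarith

/-- Consider operators `x l` satisfying `(x l)² = t * x l`, with `t` commuting with all of them,
on a finite-dimensional space generated by `W` under the `x l`. A subspace `Z` killed by
all the operators has dimension at most about `(card ι - 2)` times its codimension. -/
theorem finrank_le_of_annihilated {ι : Type*} [Fintype ι] [Nontrivial ι] (x : ι → V →ₗ[K] V)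
    (t : V →ₗ[K] V)
    (hcomm : ∀ l, x l ∘ₗ t = t ∘ₗ x l) (hsq : ∀ l, x l ∘ₗ x l = t ∘ₗ x l)
    {Z W : Submodule K V} (hZt : Z ≤ t.ker) (hZ : ∀ l, Z ≤ (x l).ker)
    (hgen : W ⊔ ⨆ l, (x l).range = ⊤) {I : ℕ} (hI : 0 < I) :
    (I : ℤ) * finrank K V ≤
      (((Fintype.card ι : ℤ) - 1) * I + 1) * finrank K (V ⧸ Z) + 2 * finrank K W * (I : ℤ) ^ 2 := by
  set S : ℕ → Submodule K V := fun i => (t ^ i).range with hS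
  have hcommp : ∀ l (i : ℕ), x l ∘ₗ (t ^ i) = (t ^ i) ∘ₗ x l := fun l i =>
    Commute.pow_right (show Commute (x l) t from hcomm l) i
  have hSx : ∀ l i, (S i).map (x l) = (x l).range.map (t ^ i) := fun l i => by
    rw [hS, ← LinearMap.range_comp, hcommp, LinearMap.range_comp]
  have hSt : ∀ i, (S i).map t = S (i + 1) := fun i => by
    simp only [hS, pow_succ', ← LinearMap.range_comp]; rfl
  have hanti : ∀ i, S (i + 1) ≤ S i := fun i => by
    rw [hS]; simp only [pow_succ]; exact LinearMap.range_comp_le_range _ _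
  have hxS : ∀ l i, (S i).map (x l) ≤ S i := fun l i => by
    rw [hSx]; exact LinearMap.map_le_range
  set v : ℕ → ℤ := fun i => finrank K (S i) with hv
  set m : ℕ → ℤ := fun i => finrank K ((S i).map Z.mkQ) with hm
  have hstep : ∀ i, v i - v (i + 1) ≤
      ((Fintype.card ι : ℤ) - 1) * (m i - m (i + 1)) + 2 * finrank K W := by
    intro i
    have h := finrank_layer_le (W := W.map (t ^ i)) x (hanti i) (hxS · i) (hxS · (i + 1))
      (fun l => ?_) hZ ?_
    · have := Submodule.finrank_map_le (t ^ i) W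
      simp only [hv, hm]
      zify at this
      linarith
    · rw [← Submodule.map_comp, hsq, Submodule.map_comp, ← hSt]
      exact Submodule.map_mono (hxS l i)
    · refine le_trans ?_ le_sup_left
      simp only [hSx]
      rw [← Submodule.map_iSup, ← Submodule.map_sup, hgen, Submodule.map_top]
  have hvm : ∀ i, v (i + 1) ≤ m i := by
    intro i
    have h1 := (S i).finrank_map_mkQ_add_finrank_inf Z
    have h2 := (S i).finrank_map_add_finrank_inf_ker t
    rw [hSt] at h2
    have h3 : finrank K ↥(Z ⊓ S i) ≤ finrank K ↥(S i ⊓ t.ker) :=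
      Submodule.finrank_mono (by rw [inf_comm]; exact inf_le_inf_left _ hZt)
    simp only [hv, hm]
    omega
  have hS0 : S 0 = ⊤ := by
    simp only [hS, pow_zero]; exact LinearMap.range_id
  have hv0 : v 0 = finrank K V := by
    simp only [hv]; rw [hS0, finrank_top]
  have hm0 : m 0 = finrank K (V ⧸ Z) := by
    simp only [hm]; rw [hS0, Submodule.map_top, Submodule.range_mkQ, finrank_top]
  have hmnn : ∀ i, 0 ≤ m i := fun i => by simp [hm]
  have htel : ∀ i, v 0 - v i ≤
      ((Fintype.card ι : ℤ) - 1) * (m 0 - m i) + 2 * finrank K W * i := by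
    intro i
    induction i with
    | zero => simp
    | succ i ih => have := hstep i; push_cast; linarith
  obtain ⟨i, hiI, hi⟩ : ∃ i < I, (I : ℤ) * (m i - m (i + 1)) ≤ m 0 := by
    by_contra! hcon
    have h1 := Finset.sum_lt_sum_of_nonempty (s := Finset.range I)
      (Finset.nonempty_range_iff.2 hI.ne') fun i hi => hcon i (Finset.mem_range.1 hi)
    rw [← Finset.mul_sum, Finset.sum_range_sub', Finset.sum_const, Finset.card_range,
      nsmul_eq_mul] at h1
    have := mul_nonneg (Int.natCast_nonneg I) (hmnn I)
    linarith
  have hcard : (2 : ℤ) ≤ Fintype.card ι := by exact_mod_cast Fintype.one_lt_card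
  have h1 := htel (i + 1)
  have h2 := hvm i
  have h3 : v 0 ≤ ((Fintype.card ι : ℤ) - 1) * m 0 + (m i - m (i + 1)) + 2 * finrank K W * I := by
    have h4 : (2 : ℤ) * finrank K W * ((i + 1 : ℕ) : ℤ) ≤ 2 * finrank K W * I := by
      gcongr; omega
    have h5 := mul_nonneg (by linarith : (0 : ℤ) ≤ Fintype.card ι - 2) (hmnn (i + 1))
    linarith
  rw [← hv0, ← hm0]
  have h6 := mul_le_mul_of_nonneg_left h3 (Int.natCast_nonneg I)
  linarith

section Graded

variable {K : Type*} [Field K] {L : ℕ → Type*} [∀ j, AddCommGroup (L j)] [∀ j, Module K (L j)]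

/-- The degree one endomorphism of the truncation of a graded space in degrees at most `n`
given by a family of maps raising the degree by one. -/
def truncatedShift (n : ℕ) (f : ∀ j, L j →ₗ[K] L (j + 1)) :
    (∀ j : Fin (n + 1), L j) →ₗ[K] ∀ j : Fin (n + 1), L j :=
  LinearMap.pi (Fin.cases 0 fun j : Fin n => f j ∘ₗ LinearMap.proj j.castSucc)

@[simp]
theorem truncatedShift_zero (n : ℕ) (f : ∀ j, L j →ₗ[K] L (j + 1))
    (v : ∀ j : Fin (n + 1), L j) : truncatedShift n f v 0 = 0 := rfl

@[simp]
theorem truncatedShift_succ (n : ℕ) (f : ∀ j, L j →ₗ[K] L (j + 1))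
    (v : ∀ j : Fin (n + 1), L j) (j : Fin n) :
    truncatedShift n f v j.succ = f j (v j.castSucc) := rfl

theorem truncatedShift_comp_eq (n : ℕ) {f g f' g' : ∀ j, L j →ₗ[K] L (j + 1)}
    (h : ∀ j, f (j + 1) ∘ₗ g j = f' (j + 1) ∘ₗ g' j) :
    truncatedShift n f ∘ₗ truncatedShift n g = truncatedShift n f' ∘ₗ truncatedShift n g' := by
  refine LinearMap.ext fun v => funext fun j => ?_
  cases j using Fin.cases with
  | zero => rfl
  | succ j =>
    cases n with
    | zero => exact j.elim0
    | succ n =>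
      cases j using Fin.cases with
      | zero => exact ((f 0).map_zero).trans ((f' 0).map_zero).symm
      | succ j => exact LinearMap.congr_fun (h j) (v j.castSucc.castSucc)

variable [∀ j, FiniteDimensional K (L j)]

/-- A graded version of `finrank_le_of_annihilated`. -/
theorem sum_finrank_le_of_annihilated {ι : Type*} [Fintype ι] [Nontrivial ι]
    (x : ι → ∀ j, L j →ₗ[K] L (j + 1)) (t : ∀ j, L j →ₗ[K] L (j + 1))
    (hcomm : ∀ l j, x l (j + 1) ∘ₗ t j = t (j + 1) ∘ₗ x l j)
    (hsq : ∀ l j, x l (j + 1) ∘ₗ x l j = t (j + 1) ∘ₗ x l j)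
    {Z : ∀ j, Submodule K (L j)} (hZt : ∀ j, Z j ≤ (t j).ker) (hZ : ∀ l j, Z j ≤ (x l j).ker)
    (hgen : ∀ j, ⨆ l, (x l j).range = ⊤) (n : ℕ) {I : ℕ} (hI : 0 < I) :
    (I : ℤ) * ∑ j ∈ Finset.range (n + 1), finrank K (L j) ≤
      (((Fintype.card ι : ℤ) - 1) * I + 1) * ∑ j ∈ Finset.range (n + 1), finrank K (L j ⧸ Z j) +
        2 * finrank K (L 0) * (I : ℤ) ^ 2 := by
  classical
  set V := ∀ j : Fin (n + 1), L j
  set W : Submodule K V := (LinearMap.single K (fun j : Fin (n + 1) => L j) 0).range with hW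
  set ZV : Submodule K V := Submodule.pi Set.univ fun j => Z j with hZV
  have hker : ∀ f : ∀ j, L j →ₗ[K] L (j + 1), (∀ j, Z j ≤ (f j).ker) →
      ZV ≤ (truncatedShift n f).ker := by
    intro f hf v hv
    rw [LinearMap.mem_ker]
    ext j
    cases j using Fin.cases with
    | zero => rfl
    | succ j => exact hf j (hv j.castSucc (Set.mem_univ _))
  have hW' : finrank K W ≤ finrank K (L 0) := LinearMap.finrank_range_le _
  have hle : ∀ j : Fin (n + 1), (LinearMap.single K (fun j : Fin (n + 1) => L j) j).range ≤
      W ⊔ ⨆ l, (truncatedShift n (x l)).range := by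
    intro j
    induction j using Fin.induction with
    | zero => exact le_sup_left
    | succ j ih =>
      rw [← Submodule.map_top]
      refine le_trans (Submodule.map_mono (hgen j).ge) ?_
      rw [Submodule.map_iSup]
      refine le_trans (iSup_mono fun l => ?_) le_sup_right
      rintro _ ⟨_, ⟨b, rfl⟩, rfl⟩
      refine ⟨LinearMap.single K (fun j : Fin (n + 1) => L j) j.castSucc b, funext fun i => ?_⟩
      cases i using Fin.cases with
      | zero => simp [(Fin.succ_ne_zero j).symm]; rfl
      | succ i =>
        rw [truncatedShift_succ]
        obtain rfl | hij := eq_or_ne i j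
        · simp
        · simp [hij]
  have h := finrank_le_of_annihilated (fun l => truncatedShift n (x l)) (truncatedShift n t)
    (fun l => truncatedShift_comp_eq n (hcomm l)) (fun l => truncatedShift_comp_eq n (hsq l))
    (hker t hZt) (fun l => hker (x l) (hZ l)) (W := W)
    (by
      rw [eq_top_iff, ← LinearMap.iSup_range_single K (fun j : Fin (n + 1) => L j)]
      exact iSup_le hle) hI
  have h1 : finrank K V = ∑ j ∈ Finset.range (n + 1), finrank K (L j) := by
    rw [Module.finrank_pi_fintype, Finset.sum_range]
  have h2 : finrank K (V ⧸ ZV) = ∑ j ∈ Finset.range (n + 1), finrank K (L j ⧸ Z j) := by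
    rw [(Submodule.quotientPi fun j : Fin (n + 1) => Z j).finrank_eq,
      Module.finrank_pi_fintype, Finset.sum_range]
  rw [h1, h2] at h
  push_cast at h ⊢
  refine h.trans ?_
  gcongr

end Graded

end LinearAlgebra

section CommutatorCalculus

open scoped commutatorElement

variable {G : Type*} [Group G]

theorem Subgroup.commutator_commutator_top_le (H : Subgroup G) [H.Normal] :
    ⁅H, _root_.commutator G⁆ ≤ ⁅⁅H, (⊤ : Subgroup G)⁆, (⊤ : Subgroup G)⁆ := by
  set N := ⁅⁅H, (⊤ : Subgroup G)⁆, (⊤ : Subgroup G)⁆ with hN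
  have hmap : ∀ K : Subgroup G, K ≤ N ↔ K.map (QuotientGroup.mk' N) = ⊥ := fun K => by
    rw [Subgroup.map_eq_bot_iff, QuotientGroup.ker_mk']
  have hH : ⁅⁅H.map (QuotientGroup.mk' N), (⊤ : Subgroup (G ⧸ N))⁆,
      (⊤ : Subgroup (G ⧸ N))⁆ = ⊥ := by
    have h := (hmap N).1 le_rfl
    conv at h => enter [1, 2]; rw [hN]
    rwa [Subgroup.map_commutator, Subgroup.map_commutator,
      Subgroup.map_top_of_surjective _ (QuotientGroup.mk'_surjective N)] at h
  rw [hmap, Subgroup.map_commutator, _root_.commutator_def, Subgroup.map_commutator,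
    Subgroup.map_top_of_surjective _ (QuotientGroup.mk'_surjective N)]
  refine (Subgroup.commutator_comm _ _).trans
    (Subgroup.commutator_commutator_eq_bot_of_rotate ?_ hH)
  rw [Subgroup.commutator_comm (⊤ : Subgroup (G ⧸ N)) (H.map _)]
  exact hH

theorem commutatorElement_mul_left_of_commute {a b g : G} (h : ∀ c, Commute ⁅b, g⁆ c) :
    ⁅a * b, g⁆ = ⁅a, g⁆ * ⁅b, g⁆ := by
  rw [commutatorElement_mul_left_eq_conj_mul, ← (h a).eq, mul_inv_cancel_right, (h _).eq]

theorem commutatorElement_mul_right_of_commute {a g h : G} (hc : ∀ c, Commute ⁅a, h⁆ c) :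
    ⁅a, g * h⁆ = ⁅a, g⁆ * ⁅a, h⁆ := by
  rw [commutatorElement_mul_right_eq_mul_conj, mul_assoc, mul_assoc, ← mul_assoc g, ← (hc g).eq,
    mul_inv_cancel_right]

theorem commutatorElement_commutatorElement_of_mul_self_eq_one {a g : G} (h : g * g = 1) :
    ⁅⁅a, g⁆, g⁆ = ⁅a, g⁆ * ⁅a, g⁆ := by
  have hg : g⁻¹ = g := inv_eq_of_mul_eq_one_left h
  simp only [commutatorElement_def, mul_inv_rev, inv_inv, hg]
  have hgg : ∀ y, g * (g * y) = y := fun y => by rw [← mul_assoc, h, one_mul]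
  simp only [mul_assoc, hgg]

end CommutatorCalculus

section Layers

open Subgroup Module

open scoped commutatorElement

/-- Groups generated by elements of order at most two. -/
class IsInvolutionGenerated (G : Type*) [Group G] : Prop where
  closure_eq_top : closure {g : G | g * g = 1} = ⊤

variable {G : Type*} [Group G]

local notation "γ" => Subgroup.lowerCentralSeries (⊤ : Subgroup G)

theorem commutator_mem_lowerCentralSeries {j : ℕ} {a : G} (ha : a ∈ γ j) (g : G) :
    ⁅a, g⁆ ∈ γ (j + 1) :=
  commutator_mem_commutator ha (mem_top g)

theorem commutator_mem_lowerCentralSeries_add_two {j : ℕ} {a b : G} (ha : a ∈ γ j)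
    (hb : b ∈ γ 1) : ⁅a, b⁆ ∈ γ (j + 2) := by
  refine commutator_commutator_top_le (γ j) (commutator_mem_commutator ha ?_)
  rwa [← top_lowerCentralSeries_one]

theorem lowerCentralSeries_succ_le (j : ℕ) : γ (j + 1) ≤ γ j :=
  Subgroup.lowerCentralSeries_antitone _ j.le_succ

/-- Elements of `γ j` are central modulo `γ (j + 1)`. -/
theorem commute_mk_of_mem_lowerCentralSeries {j : ℕ} {a : G} (ha : a ∈ γ j)
    (c : G ⧸ γ (j + 1)) : Commute (a : G ⧸ γ (j + 1)) c := by
  induction c using QuotientGroup.induction_on with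
  | H c =>
    rw [← commutatorElement_eq_one_iff_commute]
    exact (QuotientGroup.eq_one_iff _).2 (commutator_mem_lowerCentralSeries ha c)

theorem mk_commutator_mul_left {j : ℕ} (a : G) {b : G} (hb : b ∈ γ j) (g : G) :
    ((⁅a * b, g⁆ : G) : G ⧸ γ (j + 2)) = (⁅a, g⁆ : G) * (⁅b, g⁆ : G) :=
  commutatorElement_mul_left_of_commute (a := (a : G ⧸ γ (j + 2))) (b := (b : G ⧸ γ (j + 2)))
    (g := (g : G ⧸ γ (j + 2)))
    (commute_mk_of_mem_lowerCentralSeries (commutator_mem_lowerCentralSeries hb g))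

theorem mk_commutator_mul_right {j : ℕ} {a : G} (ha : a ∈ γ j) (g h : G) :
    ((⁅a, g * h⁆ : G) : G ⧸ γ (j + 2)) = (⁅a, g⁆ : G) * (⁅a, h⁆ : G) :=
  commutatorElement_mul_right_of_commute (a := (a : G ⧸ γ (j + 2))) (g := (g : G ⧸ γ (j + 2)))
    (h := (h : G ⧸ γ (j + 2)))
    (commute_mk_of_mem_lowerCentralSeries (commutator_mem_lowerCentralSeries ha h))

theorem mk_commutator_mul_self {j : ℕ} {a : G} (ha : a ∈ γ j) (g : G) :
    ((⁅a * a, g⁆ : G) : G ⧸ γ (j + 2)) = (⁅a, g⁆ * ⁅a, g⁆ : G) :=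
  mk_commutator_mul_left a ha g

theorem mk_mul_mul_mul {j : ℕ} {a b : G} (ha : a ∈ γ (j + 1)) (hb : b ∈ γ (j + 1)) :
    ((a * b * (a * b) : G) : G ⧸ γ (j + 3)) = (a * a : G) * (b * b : G) := by
  have h : Commute (a : G ⧸ γ (j + 3)) b := by
    rw [← commutatorElement_eq_one_iff_commute]
    exact (QuotientGroup.eq_one_iff _).2 (commutator_mem_lowerCentralSeries_add_two ha
      (Subgroup.lowerCentralSeries_antitone _ (Nat.le_add_left 1 j) hb))
  exact h.symm.mul_mul_mul_comm (a : G ⧸ γ (j + 3)) (b : G ⧸ γ (j + 3))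

theorem mul_self_mem_of_mem_closure {S : Set G} {N : Subgroup G} [N.Normal]
    (hS : ∀ s ∈ S, s * s ∈ N) (hcomm : ∀ a ∈ closure S, ∀ c : G ⧸ N, Commute (a : G ⧸ N) c)
    {a : G} (ha : a ∈ closure S) : a * a ∈ N := by
  induction ha using closure_induction with
  | mem g hg => exact hS g hg
  | one => rw [mul_one]; exact N.one_mem
  | mul a b ha hb h1 h2 =>
    rw [← QuotientGroup.eq_one_iff] at h1 h2 ⊢
    rw [QuotientGroup.mk_mul] at h1 h2
    rw [QuotientGroup.mk_mul, QuotientGroup.mk_mul, (hcomm a ha b).symm.mul_mul_mul_comm, h1, h2,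
      one_mul]
  | inv a _ h =>
    rw [← mul_inv_rev]
    exact N.inv_mem h

variable (G) in
/-- The `j`-th factor of the lower central series, written additively. -/
abbrev LowerCentralFactor (j : ℕ) : Type _ :=
  Additive (γ j ⧸ ((γ (j + 1)).subgroupOf (γ j) : Subgroup (γ j)))

local notation "Λ" => LowerCentralFactor G

/-- The class of an element of `γ j`. -/
def LowerCentralFactor.mk {j : ℕ} (a : γ j) : Λ j :=
  Additive.ofMul (QuotientGroup.mk a)

theorem LowerCentralFactor.mk_surjective {j : ℕ} :
    Function.Surjective (LowerCentralFactor.mk : γ j → Λ j) :=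
  QuotientGroup.mk_surjective

theorem LowerCentralFactor.mk_eq_mk_iff {j : ℕ} {a b : γ j} :
    (LowerCentralFactor.mk a : Λ j) = LowerCentralFactor.mk b ↔
      ((a : G) : G ⧸ γ (j + 1)) = (b : G) := by
  rw [QuotientGroup.eq]
  exact QuotientGroup.eq

instance (j : ℕ) : AddCommGroup (Λ j) :=
  { (inferInstance : AddGroup (Λ j)) with
    add_comm := by
      intro a b
      obtain ⟨a, rfl⟩ := LowerCentralFactor.mk_surjective a
      obtain ⟨b, rfl⟩ := LowerCentralFactor.mk_surjective b
      refine LowerCentralFactor.mk_eq_mk_iff.2 ?_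
      exact (commute_mk_of_mem_lowerCentralSeries a.2 (b : G)).eq }

theorem LowerCentralFactor.mk_mul {j : ℕ} (a b : γ j) : (LowerCentralFactor.mk (a * b) : Λ j) =
    LowerCentralFactor.mk a + LowerCentralFactor.mk b := rfl

theorem LowerCentralFactor.mk_eq_zero_iff {j : ℕ} {a : γ j} :
    (LowerCentralFactor.mk a : Λ j) = 0 ↔ (a : G) ∈ γ (j + 1) := by
  rw [← QuotientGroup.eq_one_iff]
  exact LowerCentralFactor.mk_eq_mk_iff (b := 1)

section IsInvolutionGenerated

variable [IsInvolutionGenerated G]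

theorem mul_self_mem_lowerCentralSeries {j : ℕ} {a : G} (ha : a ∈ γ j) : a * a ∈ γ (j + 1) := by
  induction j generalizing a with
  | zero =>
    have hS : closure {g : G | g * g = 1} = ⊤ := IsInvolutionGenerated.closure_eq_top
    refine mul_self_mem_of_mem_closure (S := {g : G | g * g = 1}) (fun g hg => ?_)
      (fun a _ => commute_mk_of_mem_lowerCentralSeries (j := 0) (mem_top a)) (hS ▸ mem_top a)
    rw [show g * g = 1 from hg]
    exact one_mem _
  | succ j ih =>
    refine mul_self_mem_of_mem_closure (S := {x | ∃ p ∈ γ j, ∃ q ∈ (⊤ : Subgroup G), ⁅p, q⁆ = x})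
      (fun g hg => ?_) (fun a ha => commute_mk_of_mem_lowerCentralSeries (j := j + 1) ha) ha
    obtain ⟨b, hb, c, -, rfl⟩ := hg
    have h := mk_commutator_mul_self hb c
    rwa [(QuotientGroup.eq_one_iff _).2 (commutator_mem_lowerCentralSeries (ih hb) c), eq_comm,
      QuotientGroup.eq_one_iff] at h

instance (j : ℕ) : Module (ZMod 2) (Λ j) :=
  AddCommGroup.zmodModule fun a => by
    obtain ⟨a, rfl⟩ := LowerCentralFactor.mk_surjective a
    rw [two_nsmul]
    refine (LowerCentralFactor.mk_eq_mk_iff (a := a * a) (b := 1)).2 ?_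
    exact (QuotientGroup.eq_one_iff _).2 (mul_self_mem_lowerCentralSeries a.2)

namespace LowerCentralFactor

/-- A map between factors of the lower central series induced by a function on representatives. -/
def map {i j : ℕ} (f : γ i → γ j)
    (hmul : ∀ a b, ((f (a * b) : G) : G ⧸ γ (j + 1)) = (f a : G) * (f b : G))
    (hker : ∀ a : γ i, (a : G) ∈ γ (i + 1) → (f a : G) ∈ γ (j + 1)) : Λ i →ₗ[ZMod 2] Λ j :=
  AddMonoidHom.toZModLinearMap 2 <| MonoidHom.toAdditive <|
    QuotientGroup.lift _
      (MonoidHom.mk' (fun a => QuotientGroup.mk (f a)) fun a b => mk_eq_mk_iff.2 (hmul a b))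
      fun a ha => (QuotientGroup.eq_one_iff _).2 (hker a ha)

/-- The map induced on factors by taking the commutator with a fixed element. -/
def commutatorMap (g : G) (j : ℕ) : Λ j →ₗ[ZMod 2] Λ (j + 1) :=
  map (fun a => ⟨⁅(a : G), g⁆, commutator_mem_lowerCentralSeries a.2 g⟩)
    (fun a b => mk_commutator_mul_left (a : G) b.2 g)
    fun _ ha => commutator_mem_lowerCentralSeries ha g

/-- The map induced on factors by squaring. -/
def squareMap (j : ℕ) : Λ (j + 1) →ₗ[ZMod 2] Λ (j + 2) :=
  map (fun a => ⟨(a : G) * a, mul_self_mem_lowerCentralSeries a.2⟩)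
    (fun a b => mk_mul_mul_mul a.2 b.2) fun _ ha => mul_self_mem_lowerCentralSeries ha

theorem commutatorMap_comp_squareMap (g : G) (j : ℕ) :
    commutatorMap g (j + 2) ∘ₗ squareMap j = squareMap (j + 1) ∘ₗ commutatorMap g (j + 1) := by
  refine LinearMap.ext fun a => ?_
  obtain ⟨a, rfl⟩ := mk_surjective a
  refine mk_eq_mk_iff.2 ?_
  have h : Commute ((a : G) : G ⧸ γ (j + 4)) (⁅(a : G), g⁆ : G) := by
    rw [Commute.symm_iff, ← commutatorElement_eq_one_iff_commute]
    exact (QuotientGroup.eq_one_iff _).2 (commutator_mem_lowerCentralSeries_add_two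
      (commutator_mem_lowerCentralSeries a.2 g)
      (Subgroup.lowerCentralSeries_antitone _ (Nat.le_add_left 1 j) a.2))
  change ((⁅(a : G) * a, g⁆ : G) : G ⧸ γ (j + 4)) = (⁅(a : G), g⁆ * ⁅(a : G), g⁆ : G)
  rw [commutatorElement_mul_left_eq_conj_mul, QuotientGroup.mk_mul, QuotientGroup.mk_mul,
    QuotientGroup.mk_mul, QuotientGroup.mk_inv, h.eq, mul_inv_cancel_right, QuotientGroup.mk_mul]

theorem commutatorMap_comp_commutatorMap {g : G} (hg : g * g = 1) (j : ℕ) :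
    commutatorMap g (j + 2) ∘ₗ commutatorMap g (j + 1) =
      squareMap (j + 1) ∘ₗ commutatorMap g (j + 1) := by
  refine LinearMap.ext fun a => ?_
  obtain ⟨a, rfl⟩ := mk_surjective a
  exact congrArg mk (Subtype.ext (commutatorElement_commutatorElement_of_mul_self_eq_one hg))

theorem commutatorMap_mul (g h : G) (j : ℕ) :
    commutatorMap (g * h) j = commutatorMap g j + commutatorMap h j := by
  refine LinearMap.ext fun a => ?_
  obtain ⟨a, rfl⟩ := mk_surjective a
  exact mk_eq_mk_iff.2 (mk_commutator_mul_right a.2 g h)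

theorem commutatorMap_one (j : ℕ) : commutatorMap (1 : G) j = 0 := by
  have h := commutatorMap_mul (1 : G) 1 j
  rwa [mul_one, left_eq_add] at h

theorem iSup_range_commutatorMap {ι : Type*} {x : ι → G} (hx : closure (Set.range x) = ⊤) (j : ℕ) :
    ⨆ l, (commutatorMap (x l) j).range = ⊤ := by
  set T := ⨆ l, (commutatorMap (x l) j).range
  have hT : ∀ g : G, ∀ a, commutatorMap g j a ∈ T := by
    intro g
    have hg : g ∈ closure (Set.range x) := hx ▸ mem_top g
    induction hg using closure_induction with
    | mem g hg =>
      obtain ⟨l, rfl⟩ := hg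
      exact fun a => le_iSup (fun l => (commutatorMap (x l) j).range) l ⟨a, rfl⟩
    | one => simp [commutatorMap_one]
    | mul g h _ _ hg hh =>
      intro a
      rw [commutatorMap_mul]
      exact T.add_mem (hg a) (hh a)
    | inv g _ hg =>
      intro a
      have h := commutatorMap_mul g⁻¹ g j
      rw [inv_mul_cancel, commutatorMap_one, eq_comm, ← eq_neg_iff_add_eq_zero] at h
      rw [h]
      exact T.neg_mem (hg a)
  rw [eq_top_iff]
  rintro a -
  obtain ⟨⟨a, ha⟩, rfl⟩ := mk_surjective a
  induction ha using closure_induction with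
  | mem _ h =>
    obtain ⟨p, hp, g, -, rfl⟩ := h
    exact hT g (mk ⟨p, hp⟩)
  | one => exact T.zero_mem
  | mul a b _ _ ha hb => exact T.add_mem ha hb
  | inv a _ ha => exact T.neg_mem ha

theorem span_range_mk {ι : Type*} {x : ι → G} (hx : closure (Set.range x) = ⊤) :
    Submodule.span (ZMod 2) (Set.range fun l => (mk ⟨x l, mem_top _⟩ : Λ 0)) = ⊤ := by
  rw [eq_top_iff]
  rintro a -
  obtain ⟨⟨a, ha⟩, rfl⟩ := mk_surjective a
  have hax : a ∈ closure (Set.range x) := hx ▸ ha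
  induction hax using closure_induction with
  | mem a h =>
    obtain ⟨l, rfl⟩ := h
    exact Submodule.subset_span ⟨l, rfl⟩
  | one => exact Submodule.zero_mem _
  | mul a b _ _ iha ihb => exact Submodule.add_mem _ (iha (mem_top a)) (ihb (mem_top b))
  | inv a _ iha => exact Submodule.neg_mem _ (iha (mem_top a))

/-- The image in the `j`-th factor of the intersection of a subgroup with `γ j`. -/
def image (H : Subgroup G) (j : ℕ) : Submodule (ZMod 2) (Λ j) :=
  AddSubgroup.toZModSubmodule 2
    (Subgroup.toAddSubgroup ((H.subgroupOf (γ j)).map (QuotientGroup.mk' _)))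

theorem mem_image {H : Subgroup G} {j : ℕ} {c : Λ j} :
    c ∈ image H j ↔ ∃ a : γ j, (a : G) ∈ H ∧ mk a = c := Iff.rfl

theorem image_top (j : ℕ) : image (⊤ : Subgroup G) j = ⊤ := by
  rw [eq_top_iff]
  rintro c -
  obtain ⟨a, rfl⟩ := mk_surjective c
  exact mem_image.2 ⟨a, mem_top _, rfl⟩

theorem finrank_image_top (j : ℕ) :
    finrank (ZMod 2) (image (⊤ : Subgroup G) j) = finrank (ZMod 2) (Λ j) := by
  rw [image_top, finrank_top]

theorem image_le_ker_commutatorMap {H : Subgroup G} (hH : H ≤ center G) (g : G) (j : ℕ) :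
    image H j ≤ (commutatorMap g j).ker := by
  rintro _ ⟨a, ha, rfl⟩
  refine mk_eq_zero_iff.2 ?_
  change ⁅(a : G), g⁆ ∈ _
  rw [commutatorElement_eq_one_iff_commute.2 (show Commute (a : G) g from
    (mem_center_iff.1 (hH ha) g).symm)]
  exact one_mem _

theorem image_le_ker_squareMap {H : Subgroup G} (hH : ∀ a ∈ H, a * a = 1) (j : ℕ) :
    image H (j + 1) ≤ (squareMap j).ker := by
  rintro _ ⟨a, ha, rfl⟩
  refine mk_eq_zero_iff.2 ?_
  change (a : G) * a ∈ _
  rw [hH a ha]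
  exact one_mem _

variable [Finite G]

theorem card_inf_eq (H : Subgroup G) (j : ℕ) :
    Nat.card ↥(H ⊓ γ j) =
      2 ^ finrank (ZMod 2) (image H j) * Nat.card ↥(H ⊓ γ (j + 1)) := by
  have h1 : Nat.card (image H j) = (H ⊓ γ (j + 1)).relIndex (H ⊓ γ j) := by
    have h : ((γ (j + 1)).subgroupOf (γ j)).relIndex (H.subgroupOf (γ j)) =
        Nat.card ((H.subgroupOf (γ j)).map (QuotientGroup.mk' ((γ (j + 1)).subgroupOf (γ j)))) := by
      rw [← relIndex_ker, QuotientGroup.ker_mk']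
    rw [← H.inf_subgroupOf_right, relIndex_subgroupOf inf_le_right,
      ← inf_relIndex_right, inf_left_comm, inf_eq_left.2 (lowerCentralSeries_succ_le j)] at h
    rw [h, inf_subgroupOf_right]
    rfl
  have h2 := Module.natCard_eq_pow_finrank (K := ZMod 2) (V := image H j)
  rw [Nat.card_zmod] at h2
  rw [← h2, h1, mul_comm, ← relIndex_bot_left, ← relIndex_bot_left]
  exact (relIndex_mul_relIndex _ _ _ bot_le
    (inf_le_inf_left _ (lowerCentralSeries_succ_le j))).symm

theorem card_inf_commutator_eq (H : Subgroup G) (n : ℕ) :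
    Nat.card ↥(H ⊓ γ 1) = 2 ^ (∑ j ∈ Finset.range n, finrank (ZMod 2) (image H (j + 1))) *
      Nat.card ↥(H ⊓ γ (n + 1)) := by
  induction n with
  | zero => simp
  | succ n ih => rw [ih, card_inf_eq H (n + 1), Finset.sum_range_succ, pow_add, mul_assoc]

end LowerCentralFactor

end IsInvolutionGenerated

open LowerCentralFactor

/-- A finite `2`-group `G` generated by involutions is not much larger than its quotient by an
elementary abelian central subgroup `Z`. -/
theorem exponent_le_of_le_center [Finite G] {ι : Type*} [Fintype ι] [Nontrivial ι] {x : ι → G}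
    (hx2 : ∀ l, x l * x l = 1) (hx : closure (Set.range x) = ⊤) {Z : Subgroup G}
    (hZ : Z ≤ center G) (hZ2 : ∀ z ∈ Z, z * z = 1) {e k : ℕ} (he : Nat.card G = 2 ^ e)
    (hk : Z.index = 2 ^ k) {I : ℕ} (hI : 0 < I) :
    (I : ℤ) * e ≤ (((Fintype.card ι : ℤ) - 1) * I + 1) * k + Fintype.card ι * I +
      2 * (Fintype.card ι : ℤ) ^ 2 * (I : ℤ) ^ 2 := by
  have : IsInvolutionGenerated G :=
    ⟨top_unique (hx ▸ closure_mono (Set.range_subset_iff.2 hx2))⟩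
  obtain ⟨n, hn⟩ : ∃ n, γ (n + 1 + 1) = ⊥ := by
    have := (IsPGroup.of_card he).isNilpotent
    obtain ⟨n, hn⟩ := Subgroup.nilpotent_iff_lowerCentralSeries.1 this
    exact ⟨n, le_bot_iff.1 (hn ▸ Subgroup.lowerCentralSeries_antitone _ (by omega))⟩
  have h0 : finrank (ZMod 2) (Λ 0) ≤ Fintype.card ι := by
    have := finrank_range_le_card (R := ZMod 2) (fun l => (mk ⟨x l, mem_top _⟩ : Λ 0))
    rwa [Set.finrank, span_range_mk hx, finrank_top] at this
  have h1 : finrank (ZMod 2) (Λ 1) ≤ Fintype.card ι ^ 2 := by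
    have h := Submodule.finrank_iSup_le_sum_finrank fun l => (commutatorMap (x l) 0).range
    rw [iSup_range_commutatorMap hx, finrank_top] at h
    refine h.trans ((Finset.sum_le_card_nsmul _ _ (Fintype.card ι) fun l _ =>
      (LinearMap.finrank_range_le _).trans h0).trans_eq ?_)
    rw [Finset.card_univ, smul_eq_mul, sq]
  have hmain := sum_finrank_le_of_annihilated (L := fun j => Λ (j + 1))
    (fun l j => commutatorMap (x l) (j + 1)) squareMap
    (fun l j => commutatorMap_comp_squareMap (x l) j)
    (fun l j => commutatorMap_comp_commutatorMap (hx2 l) j)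
    (Z := fun j => image Z (j + 1)) (fun j => image_le_ker_squareMap hZ2 j)
    (fun l j => image_le_ker_commutatorMap hZ (x l) (j + 1))
    (fun j => iSup_range_commutatorMap hx (j + 1)) n hI
  have hG := card_inf_eq (⊤ : Subgroup G) 0
  have hG1 := card_inf_commutator_eq (⊤ : Subgroup G) (n + 1)
  have hZ1 := card_inf_commutator_eq Z (n + 1)
  simp only [hn, finrank_image_top, zero_add, inf_bot_eq, card_bot, mul_one] at hG1 hZ1 hG
  set A := ∑ j ∈ Finset.range (n + 1), finrank (ZMod 2) (Λ (j + 1)) with hA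
  set B := ∑ j ∈ Finset.range (n + 1), finrank (ZMod 2) (image Z (j + 1)) with hB
  have he' : e = finrank (ZMod 2) (Λ 0) + A := by
    rw [hG1, ← pow_add] at hG
    refine Nat.pow_right_injective le_rfl (he.symm.trans (.trans ?_ hG))
    rw [Subgroup.lowerCentralSeries_zero, top_inf_eq, card_top]
  have hAB : A ≤ B + k := by
    rw [← Nat.pow_dvd_pow_iff_le_right (by norm_num : 1 < 2), pow_add, ← hG1, ← hZ1, ← hk]
    have : Z.Normal :=
      ⟨fun z hz g => by rwa [mem_center_iff.1 (hZ hz) g, mul_inv_cancel_right]⟩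
    rw [top_inf_eq, ← relIndex_bot_left, ← relIndex_bot_left,
      ← relIndex_mul_relIndex ⊥ (Z ⊓ γ 1) (γ 1) bot_le inf_le_right, inf_relIndex_right]
    exact mul_dvd_mul_left _ (relIndex_dvd_index_of_normal _ _)
  have hquot : (∑ j ∈ Finset.range (n + 1), finrank (ZMod 2) (Λ (j + 1) ⧸ image Z (j + 1))) + B
      = A := by
    rw [hA, hB, ← Finset.sum_add_distrib]
    exact Finset.sum_congr rfl fun j _ => Submodule.finrank_quotient_add_finrank _
  have hd : (0 : ℤ) ≤ ((Fintype.card ι : ℤ) - 1) * I + 1 := by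
    have : (1 : ℤ) ≤ Fintype.card ι := by exact_mod_cast Fintype.card_pos
    have := mul_nonneg (sub_nonneg.2 this) (Int.natCast_nonneg I)
    linarith
  set S := ∑ j ∈ Finset.range (n + 1), finrank (ZMod 2) (Λ (j + 1) ⧸ image Z (j + 1))
  have hS : (S : ℤ) ≤ k := by omega
  zify at h0 h1
  have h2 := mul_le_mul_of_nonneg_left hS hd
  have h3 := mul_le_mul_of_nonneg_right h1 (sq_nonneg (I : ℤ))
  have h4 := mul_le_mul_of_nonneg_left h0 (Int.natCast_nonneg I)
  rw [he']
  push_cast at hmain ⊢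
  linarith

end Layers

section Counting

open Subgroup

/-- A finite abelian group has at most as many subgroups of index two as elements. -/
theorem card_le_natCard_of_index_eq_two {A : Type*} [CommGroup A] [Finite A]
    {T : Finset (Subgroup A)} (hT : ∀ H ∈ T, H.index = 2) : T.card ≤ Nat.card A := by
  classical
  let χ : T → A →* ℂˣ := fun H => MonoidHom.mk' (fun a => if a ∈ H.1 then 1 else -1) fun a b => by
    have := mul_mem_iff_of_index_two (hT H.1 H.2) (a := a) (b := b)
    by_cases ha : a ∈ H.1 <;> by_cases hb : b ∈ H.1 <;> simp [this, ha, hb]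
  have hχ : ∀ H a, χ H a = 1 ↔ a ∈ H.1 := fun H a => by
    have : (-1 : ℂˣ) ≠ 1 := fun h => by
      have := congrArg Units.val h
      norm_num at this
    change (if a ∈ H.1 then (1 : ℂˣ) else -1) = 1 ↔ _
    split_ifs with h <;> simp [h, this]
  have hinj : Function.Injective χ := fun H H' h =>
    Subtype.ext (Subgroup.ext fun a => by rw [← hχ, ← hχ, h])
  rw [← CommGroup.card_monoidHom_of_hasEnoughRootsOfUnity A ℂ, ← Nat.card_eq_finsetCard]
  exact Nat.card_le_card_of_injective χ hinj

variable {P ι : Type*} [Group P] [Fintype ι] [Nontrivial ι] {x : ι → P}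

theorem mul_mem_iff_of_relIndex_two {N N' : Subgroup P} (h : N.relIndex N' = 2) {a b : P}
    (ha : a ∈ N') (hb : b ∈ N') : a * b ∈ N ↔ (a ∈ N ↔ b ∈ N) :=
  mul_mem_iff_of_index_two h (a := (⟨a, ha⟩ : N')) (b := ⟨b, hb⟩)

/-- Normal subgroups of index two in `N'` correspond to subgroups of index two in an elementary
abelian central subgroup of a quotient, whose order is bounded by `exponent_le_of_le_center`. -/
theorem card_le_of_normal_of_index (hx2 : ∀ l, x l * x l = 1) (hx : closure (Set.range x) = ⊤)
    {N' : Subgroup P} [N'.Normal] {k : ℕ} (hN' : N'.index = 2 ^ k) {T : Finset (Subgroup P)}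
    (hT : ∀ N ∈ T, N.Normal ∧ N ≤ N' ∧ N.index = 2 ^ (k + 1)) {I : ℕ} (hI : 0 < I) :
    T.card ≤ 2 ^ ((((Fintype.card ι - 2) * I + 1) * k + Fintype.card ι * I +
      2 * Fintype.card ι ^ 2 * I ^ 2) / I) := by
  classical
  have hrel : ∀ N ∈ T, N.relIndex N' = 2 := fun N hN => by
    have h := relIndex_mul_index (hT N hN).2.1
    rw [hN', (hT N hN).2.2, pow_succ'] at h
    exact Nat.eq_of_mul_eq_mul_right (by positivity) h
  set K := N' ⊓ ⨅ N : T, (N : Subgroup P) with hK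
  have hKN : ∀ N ∈ T, K ≤ N := fun N hN => inf_le_right.trans (iInf_le _ (⟨N, hN⟩ : T))
  have hmemK : ∀ g ∈ N', (∀ N ∈ T, g ∈ N) → g ∈ K := fun g hg h =>
    mem_inf.2 ⟨hg, mem_iInf.2 fun N => h N.1 N.2⟩
  have : K.Normal := by
    have : ∀ N : T, (N : Subgroup P).Normal := fun N => (hT N.1 N.2).1
    have := normal_iInf_normal this
    infer_instance
  have : K.FiniteIndex := by
    have : N'.FiniteIndex := ⟨by rw [hN']; positivity⟩
    have : (⨅ N : T, (N : Subgroup P)).FiniteIndex :=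
      finiteIndex_iInf fun N => ⟨by rw [(hT N.1 N.2).2.2]; positivity⟩
    infer_instance
  have hsq : ∀ g ∈ N', g * g ∈ K := fun g hg =>
    hmemK _ (mul_mem hg hg) fun N hN => (mul_mem_iff_of_relIndex_two (hrel N hN) hg hg).2 Iff.rfl
  have hcomm : ∀ g ∈ N', ∀ p, g * (p * g⁻¹ * p⁻¹) ∈ K := fun g hg p => by
    have hg' : p * g⁻¹ * p⁻¹ ∈ N' := Normal.conj_mem ‹_› _ (inv_mem hg) p
    refine hmemK _ (mul_mem hg hg') fun N hN =>
      (mul_mem_iff_of_relIndex_two (hrel N hN) hg hg').2 ?_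
    rw [← (hT N hN).1.mem_comm_iff, inv_mul_cancel_left, inv_mem_iff]
  set π := QuotientGroup.mk' K
  have hπ : Function.Surjective π := QuotientGroup.mk'_surjective K
  have hker : π.ker = K := QuotientGroup.ker_mk' K
  have hp : IsPGroup 2 (P ⧸ K) := by
    intro g
    obtain ⟨g, rfl⟩ := hπ g
    refine ⟨k + 1, ?_⟩
    rw [← map_pow, pow_succ, pow_mul, sq]
    refine (QuotientGroup.eq_one_iff _).2 (hsq _ ?_)
    rw [← hN']
    exact N'.pow_index_mem g
  obtain ⟨e, he⟩ := IsPGroup.iff_card.1 hp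
  have hKN' : π.ker ≤ N' := hker.trans_le inf_le_left
  have hZk : (N'.map π).index = 2 ^ k := (N'.index_map_eq hπ hKN').trans hN'
  have hZ : N'.map π ≤ center (P ⧸ K) := by
    rintro _ ⟨g, hg, rfl⟩
    rw [mem_center_iff]
    intro p
    obtain ⟨p, rfl⟩ := hπ p
    have h : π (g * (p * g⁻¹ * p⁻¹)) = 1 := (QuotientGroup.eq_one_iff _).2 (hcomm g hg p)
    simp only [map_mul, map_inv] at h
    rw [← mul_assoc, ← mul_assoc, mul_inv_eq_one, mul_inv_eq_iff_eq_mul] at h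
    exact h.symm
  have hgen : closure (Set.range fun l => π (x l)) = ⊤ := by
    rw [Set.range_comp' π x, ← MonoidHom.map_closure, hx, map_top_of_surjective _ hπ]
  have hZsq : ∀ z ∈ N'.map π, z * z = 1 := by
    rintro _ ⟨g, hg, rfl⟩
    rw [← map_mul]
    exact (QuotientGroup.eq_one_iff _).2 (hsq g hg)
  have hmain := exponent_le_of_le_center (x := fun l => π (x l))
    (fun l => by rw [← map_mul, hx2, map_one]) hgen hZ hZsq he hZk hI
  have hke : k ≤ e := by
    refine (Nat.pow_le_pow_iff_right one_lt_two).1 ?_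
    rw [← he, ← hZk]
    exact Nat.le_of_dvd Nat.card_pos (index_dvd_card _)
  obtain ⟨r, rfl⟩ := Nat.exists_eq_add_of_le hke
  have hZcard : Nat.card (N'.map π) = 2 ^ r := by
    have h := card_mul_index (N'.map π)
    rw [hZk, he, pow_add, mul_comm] at h
    exact Nat.eq_of_mul_eq_mul_left (by positivity) h
  let _ : CommGroup (N'.map π) :=
    { (inferInstance : Group (N'.map π)) with
      mul_comm := fun a b => Subtype.ext (mem_center_iff.1 (hZ b.2) a) }
  have hT' : T.card ≤ Nat.card (N'.map π) := by
    let f : Subgroup P → Subgroup (N'.map π) := fun N => (N.map π).subgroupOf (N'.map π)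
    have hf : Set.InjOn f T := by
      intro N hN M hM h
      have key : ∀ {N}, N ∈ T → ((f N).map (N'.map π).subtype).comap π = N := fun {N} hN => by
        rw [subgroupOf_map_subtype, inf_of_le_left (map_mono (hT N hN).2.1),
          comap_map_eq_self (hker.trans_le (hKN N hN))]
      rw [← key hN, ← key hM, h]
    rw [← Finset.card_image_of_injOn hf]
    refine card_le_natCard_of_index_eq_two fun H hH => ?_
    obtain ⟨N, hN, rfl⟩ := Finset.mem_image.1 hH
    have hi := relIndex_mul_index (map_mono (f := π) (hT N hN).2.1)
    rw [N.index_map_eq hπ (hker.trans_le (hKN N hN)), hZk, (hT N hN).2.2, pow_succ'] at hi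
    exact Nat.eq_of_mul_eq_mul_right (by positivity) hi
  refine hT'.trans (hZcard.trans_le (Nat.pow_le_pow_right two_pos ?_))
  rw [Nat.le_div_iff_mul_le hI]
  have hd : 2 ≤ Fintype.card ι := Fintype.one_lt_card
  obtain ⟨c, hc⟩ := Nat.exists_eq_add_of_le' hd
  rw [hc] at hmain ⊢
  rw [Nat.add_sub_cancel]
  zify
  push_cast at hmain
  linarith

/-- A normal subgroup of index `2 ^ (k + 1)` lies in one of index `2 ^ k`. -/
theorem exists_normal_le_of_index_eq_two_pow_succ {P : Type*} [Group P] {N : Subgroup P} [N.Normal]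
    {k : ℕ} (hN : N.index = 2 ^ (k + 1)) :
    ∃ N' : Subgroup P, N'.Normal ∧ N ≤ N' ∧ N'.index = 2 ^ k := by
  have hcard : Nat.card (P ⧸ N) = 2 ^ (k + 1) := hN
  have hp : IsPGroup 2 (P ⧸ N) := IsPGroup.of_card hcard
  have : Finite (P ⧸ N) := Nat.finite_of_card_ne_zero (by rw [hcard]; positivity)
  have : Nontrivial (P ⧸ N) := Finite.one_lt_card_iff_nontrivial.1 (by
    rw [hcard]; exact Nat.one_lt_two_pow k.succ_ne_zero)
  have := hp.center_nontrivial
  obtain ⟨n, hn0, hn⟩ := (hp.to_subgroup (center (P ⧸ N))).nontrivial_iff_card.1 this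
  obtain ⟨z, hz⟩ := exists_prime_orderOf_dvd_card' 2 (hn ▸ dvd_pow_self 2 hn0.ne')
  have hz2 : Nat.card (zpowers (z : P ⧸ N)) = 2 := by
    rw [Nat.card_zpowers, orderOf_coe, hz]
  have : (zpowers (z : P ⧸ N)).Normal :=
    ⟨fun a ha g => by
      rwa [mem_center_iff.1 (zpowers_le.2 z.2 ha) g, mul_inv_cancel_right]⟩
  refine ⟨(zpowers (z : P ⧸ N)).comap (QuotientGroup.mk' N), inferInstance, ?_, ?_⟩
  · exact (QuotientGroup.ker_mk' N).ge.trans (ker_le_comap _ _)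
  · rw [index_comap_of_surjective _ (QuotientGroup.mk'_surjective N)]
    have h := card_mul_index (zpowers (z : P ⧸ N))
    rw [hz2, hcard, pow_succ'] at h
    exact Nat.eq_of_mul_eq_mul_left two_pos h

theorem card_le_of_normal_of_index_eq_two_pow (hx2 : ∀ l, x l * x l = 1)
    (hx : closure (Set.range x) = ⊤) {I : ℕ} (hI : 0 < I) (m : ℕ) {T : Finset (Subgroup P)}
    (hT : ∀ N ∈ T, N.Normal ∧ N.index = 2 ^ m) :
    T.card ≤ 2 ^ ∑ k ∈ Finset.range m, (((Fintype.card ι - 2) * I + 1) * k + Fintype.card ι * I +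
      2 * Fintype.card ι ^ 2 * I ^ 2) / I := by
  classical
  induction m generalizing T with
  | zero =>
    rw [Finset.sum_range_zero, pow_zero, Finset.card_le_one]
    intro N hN M hM
    rw [index_eq_one.1 (hT N hN).2, index_eq_one.1 (hT M hM).2]
  | succ k ih =>
    have hex : ∀ N ∈ T, ∃ N' : Subgroup P, N'.Normal ∧ N ≤ N' ∧ N'.index = 2 ^ k :=
      fun N hN => have := (hT N hN).1; exists_normal_le_of_index_eq_two_pow_succ (hT N hN).2
    choose! f hf using hex
    rw [Finset.sum_range_succ, pow_add, mul_comm]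
    have him : (T.image f).card ≤ _ := ih (T := T.image f) (by
      intro N' hN'
      obtain ⟨N, hN, rfl⟩ := Finset.mem_image.1 hN'
      exact ⟨(hf N hN).1, (hf N hN).2.2⟩)
    refine (Finset.card_le_mul_card_image T _ fun N' hN' => ?_).trans (Nat.mul_le_mul_left _ him)
    obtain ⟨N, hN, rfl⟩ := Finset.mem_image.1 hN'
    have := (hf N hN).1
    refine card_le_of_normal_of_index hx2 hx (hf N hN).2.2 (fun M hM => ?_) hI
    obtain ⟨hM, hMN⟩ := Finset.mem_filter.1 hM
    exact ⟨(hT M hM).1, hMN ▸ (hf M hM).2.1, (hT M hM).2⟩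

end Counting

section Involutions

open Subgroup

/-- The free product of `d` groups of order two. -/
abbrev FreeInvolutionGroup (d : ℕ) : Type :=
  PresentedGroup (Set.range fun i : Fin d => FreeGroup.of i * FreeGroup.of i)

theorem FreeInvolutionGroup.of_mul_of {d : ℕ} (i : Fin d) :
    (PresentedGroup.of i * PresentedGroup.of i : FreeInvolutionGroup d) = 1 :=
  PresentedGroup.one_of_mem ⟨i, rfl⟩

theorem InvolGenGroup.exists_surjective {d m : ℕ} (A : InvolGenGroup d m) :
    ∃ φ : FreeInvolutionGroup d →* A.G, Function.Surjective φ := by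
  let e := (A.S.equivFinOfCardEq A.card_S).symm
  have h : ∀ r ∈ Set.range fun i : Fin d => FreeGroup.of i * FreeGroup.of i,
      FreeGroup.lift (fun i => (e i : A.G)) r = 1 := by
    rintro _ ⟨i, rfl⟩
    have := pow_orderOf_eq_one (e i : A.G)
    rw [A.invol _ (e i).2, sq] at this
    simpa using this
  refine ⟨PresentedGroup.toGroup h, ?_⟩
  rw [← MonoidHom.range_eq_top, eq_top_iff, ← A.gen, closure_le]
  intro s hs
  exact ⟨PresentedGroup.of (e.symm ⟨s, hs⟩), by simp [PresentedGroup.toGroup.of]⟩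

theorem gCount_le_of_forall_card_le {d m B : ℕ}
    (hB : ∀ T : Finset (Subgroup (FreeInvolutionGroup d)),
      (∀ N ∈ T, N.Normal ∧ N.index = 2 ^ m) → T.card ≤ B) : gCount d m ≤ B := by
  classical
  rcases finite_or_infinite (Quotient (involGenSetoid d m)) with hfin | hinf
  · choose φ hφ using InvolGenGroup.exists_surjective (d := d) (m := m)
    let F : Quotient (involGenSetoid d m) → Subgroup (FreeInvolutionGroup d) :=
      fun q => (φ q.out).ker
    have hF : Function.Injective F := fun q q' h => by
      rw [← q.out_eq, ← q'.out_eq]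
      exact Quotient.sound ⟨(QuotientGroup.quotientKerEquivOfSurjective _ (hφ q.out)).symm.trans
        ((QuotientGroup.quotientMulEquivOfEq h).trans
          (QuotientGroup.quotientKerEquivOfSurjective _ (hφ q'.out)))⟩
    have := Fintype.ofFinite (Quotient (involGenSetoid d m))
    rw [gCount, Nat.card_eq_fintype_card, ← Finset.card_univ, ← Finset.card_image_of_injective _ hF]
    refine hB _ fun N hN => ?_
    obtain ⟨q, -, rfl⟩ := Finset.mem_image.1 hN
    refine ⟨inferInstance, ?_⟩
    rw [index_ker, MonoidHom.range_eq_top.2 (hφ _), card_top, q.out.card_eq]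
  · rw [gCount, Nat.card_eq_zero_of_infinite]
    exact Nat.zero_le B

theorem gCount_le_two_pow_sum {d : ℕ} (hd : 2 ≤ d) (m : ℕ) {I : ℕ} (hI : 0 < I) :
    gCount d m ≤
      2 ^ ∑ k ∈ Finset.range m, (((d - 2) * I + 1) * k + d * I + 2 * d ^ 2 * I ^ 2) / I := by
  have : Nontrivial (Fin d) := Fin.nontrivial_iff_two_le.2 hd
  refine gCount_le_of_forall_card_le fun T hT => ?_
  simpa only [Fintype.card_fin] using card_le_of_normal_of_index_eq_two_pow
    (FreeInvolutionGroup.of_mul_of (d := d)) (PresentedGroup.closure_range_of _) hI m hT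

end Involutions

theorem two_mul_mul_sum_div_le (a b I m : ℕ) :
    2 * (I * ∑ k ∈ Finset.range m, (a * k + b) / I) ≤ a * m ^ 2 + 2 * b * m := by
  induction m with
  | zero => simp
  | succ m ih =>
    rw [Finset.sum_range_succ]
    have := Nat.mul_div_le (a * m + b) I
    nlinarith

/-- For every `d ≥ 3` and `ε > 0`, for all sufficiently large `m`,
`g_d(m) ≤ 2^(((d−2)/2 + ε)·m²)`. -/
theorem gCount_upper_bound (d : ℕ) (hd : 3 ≤ d) (ε : ℝ) (hε : 0 < ε) :
    ∃ m₀ : ℕ, ∀ m : ℕ, m₀ ≤ m →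
      (gCount d m : ℝ) ≤ 2 ^ ((((d : ℝ) - 2) / 2 + ε) * (m : ℝ) ^ 2) := by
  obtain ⟨n, hn⟩ := exists_nat_one_div_lt hε
  set I := n + 1 with hI
  have hIε : 1 ≤ ε * I := by
    rw [div_lt_iff₀ (by positivity)] at hn
    rw [hI]
    push_cast
    exact hn.le
  set D := d * I + 2 * d ^ 2 * I ^ 2 with hD
  obtain ⟨m₀, hm₀⟩ := exists_nat_ge (2 * (D : ℝ))
  refine ⟨m₀, fun m hm => ?_⟩
  have hbound := gCount_le_two_pow_sum (by lia : 2 ≤ d) m n.succ_pos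
  have hsum := two_mul_mul_sum_div_le ((d - 2) * I + 1) D I m
  simp only [hD, ← add_assoc] at hsum
  set s := ∑ k ∈ Finset.range m, (((d - 2) * I + 1) * k + d * I + 2 * d ^ 2 * I ^ 2) / I
  have hsum' : 2 * ((I : ℝ) * s) ≤ ((d - 2) * I + 1) * m ^ 2 + 2 * D * m := by
    have h : ((2 * (I * s) : ℕ) : ℝ) ≤ (((d - 2) * I + 1) * m ^ 2 + 2 * D * m : ℕ) := by
      exact_mod_cast hsum
    push_cast [Nat.cast_sub (by lia : 2 ≤ d)] at h
    exact h
  have hDm : 2 * (D : ℝ) * m ≤ m ^ 2 := by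
    rw [sq]
    exact mul_le_mul_of_nonneg_right (hm₀.trans (by exact_mod_cast hm)) m.cast_nonneg
  have hI0 : (0 : ℝ) < I := by positivity
  have hs : (s : ℝ) ≤ (((d : ℝ) - 2) / 2 + ε) * (m : ℝ) ^ 2 := by
    have := mul_le_mul_of_nonneg_right hIε (sq_nonneg (m : ℝ))
    refine le_of_mul_le_mul_left ?_ (mul_pos two_pos hI0)
    nlinarith
  calc (gCount d m : ℝ) ≤ (2 ^ s : ℕ) := by exact_mod_cast hbound
    _ = (2 : ℝ) ^ (s : ℝ) := by rw [Real.rpow_natCast]; push_cast; rfl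
    _ ≤ _ := Real.rpow_le_rpow_of_exponent_le one_le_two hs
end

section
/- For every integer d ≥ 3 and every real ε > 0 there exists m₀ such that for all integers m ≥ m₀, the number g_d(m) of isomorphism classes of groups of order 2^m which admit a generating set consisting of d involutions satisfies g_d(m) ≥ 2^{((d−2)²/(8d) − ε)·m²}. -/
instance finite_quotient_involGenSetoid (d m : ℕ) : Finite (Quotient (involGenSetoid d m)) := by
  have hfin (A : InvolGenGroup d m) : Finite A.G :=
    Nat.finite_of_card_ne_zero (by rw [A.card_eq]; positivity)
  have e (A : InvolGenGroup d m) : A.G ≃ Fin (2 ^ m) := Finite.equivFinOfCardEq A.card_eq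
  refine Finite.of_injective
    (fun q : Quotient (involGenSetoid d m) ↦ fun x y : Fin (2 ^ m) ↦
      e q.out ((e q.out).symm x * (e q.out).symm y)) fun q q' h ↦ ?_
  rw [← q.out_eq, ← q'.out_eq]
  refine Quotient.sound ⟨⟨(e q.out).trans (e q'.out).symm, fun x y ↦ ?_⟩⟩
  have := congrFun (congrFun h (e q.out x)) (e q.out y)
  simp only [Equiv.symm_apply_apply] at this
  simp [this]

/-- The subgroup of a group containing `A × B` (for elementary abelian `2`-groups `A`, `B`) given
by the graph of a linear map `A → B`. -/
def graphSubgroup {P : Type} [Group P] {a j : ℕ}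
    (ι : Multiplicative ((Fin a → ZMod 2) × (Fin j → ZMod 2)) →* P)
    (X : Matrix (Fin j) (Fin a) (ZMod 2)) : Subgroup P :=
  (ι.comp (AddMonoidHom.toMultiplicative
    ((AddMonoidHom.id _).prod X.mulVecLin.toAddMonoidHom))).range

section GraphSubgroup

variable {P : Type} [Group P] {a j : ℕ}
  {ι : Multiplicative ((Fin a → ZMod 2) × (Fin j → ZMod 2)) →* P}

theorem mem_graphSubgroup {X : Matrix (Fin j) (Fin a) (ZMod 2)} {g : P} :
    g ∈ graphSubgroup ι X ↔ ∃ v, ι (Multiplicative.ofAdd (v, X.mulVec v)) = g :=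
  Iff.rfl

theorem graphSubgroup_le_range (X : Matrix (Fin j) (Fin a) (ZMod 2)) :
    graphSubgroup ι X ≤ ι.range := by
  rintro _ ⟨v, rfl⟩
  exact ⟨_, rfl⟩

theorem card_graphSubgroup (hι : Function.Injective ι) (X : Matrix (Fin j) (Fin a) (ZMod 2)) :
    Nat.card (graphSubgroup ι X) = 2 ^ a := by
  have hinj : Function.Injective (ι.comp (AddMonoidHom.toMultiplicative
      ((AddMonoidHom.id _).prod X.mulVecLin.toAddMonoidHom))) :=
    hι.comp fun v w h ↦ congrArg Prod.fst (h : (v, X.mulVec v) = (w, X.mulVec w))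
  rw [graphSubgroup, ← Nat.card_congr (MonoidHom.ofInjective hinj).toEquiv]
  change Nat.card (Fin a → ZMod 2) = 2 ^ a
  simp

theorem graphSubgroup_injective (hι : Function.Injective ι) :
    Function.Injective (graphSubgroup ι) := by
  intro X Y h
  refine Matrix.mulVec_injective (funext fun v ↦ ?_)
  have hv : ι (Multiplicative.ofAdd (v, X.mulVec v)) ∈ graphSubgroup ι Y :=
    h ▸ mem_graphSubgroup.2 ⟨v, rfl⟩
  obtain ⟨w, hw⟩ := mem_graphSubgroup.1 hv
  have := Multiplicative.ofAdd.injective (hι hw)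
  simp only [Prod.mk.injEq] at this
  rw [← this.2, this.1]

end GraphSubgroup

/-- Quotients of a group `P` generated by involutions by subgroups of a central elementary abelian
subgroup of rank `a + j` give many isomorphism classes of groups generated by involutions. -/
theorem two_pow_le_gCount_mul {P : Type} [Group P] {I : Type} [Fintype I] {a j m : ℕ} (T : I → P)
    (ι : Multiplicative ((Fin a → ZMod 2) × (Fin j → ZMod 2)) →* P) (hι : Function.Injective ι)
    (hcent : ∀ z, ι z ∈ Subgroup.center P) (hcard : Nat.card P = 2 ^ (m + a))
    (hT : Subgroup.closure (Set.range T) = ⊤) (hsq : ∀ i, T i * T i = 1)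
    (hne : ∀ i, T i ∉ ι.range) (hdist : ∀ i i', (T i)⁻¹ * T i' ∈ ι.range → i = i') :
    2 ^ (j * a) ≤ gCount (Fintype.card I) m * (2 ^ m) ^ Fintype.card I := by
  have hnorm (X) : (graphSubgroup ι X).Normal := by
    refine ⟨fun n hn g ↦ ?_⟩
    obtain ⟨v, rfl⟩ := mem_graphSubgroup.1 hn
    rw [(Subgroup.mem_center_iff.1 (hcent _)) g, mul_inv_cancel_right]
    exact hn
  let t (X) (i : I) : P ⧸ graphSubgroup ι X := QuotientGroup.mk' _ (T i)
  have ht_inj (X) : Function.Injective (t X) := fun i i' h ↦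
    hdist i i' (graphSubgroup_le_range X (QuotientGroup.eq.1 h))
  have ht_gen (X) : Subgroup.closure (Set.range (t X)) = ⊤ := by
    have : Set.range (t X) = QuotientGroup.mk' (graphSubgroup ι X) '' Set.range T := by
      rw [← Set.range_comp]; rfl
    rw [this, ← MonoidHom.map_closure, hT, ← MonoidHom.range_eq_map, MonoidHom.range_eq_top]
    exact QuotientGroup.mk'_surjective _
  let A (X : Matrix (Fin j) (Fin a) (ZMod 2)) : InvolGenGroup (Fintype.card I) m :=
    { G := P ⧸ graphSubgroup ι X
      card_eq := by
        have h := Subgroup.card_eq_card_quotient_mul_card_subgroup (graphSubgroup ι X)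
        rw [hcard, card_graphSubgroup hι, pow_add] at h
        exact (Nat.eq_of_mul_eq_mul_right (by positivity) h).symm
      S := Finset.univ.map ⟨t X, ht_inj X⟩
      card_S := by simp
      invol := by
        simp only [Finset.mem_map, Finset.mem_univ, true_and, Function.Embedding.coeFn_mk,
          forall_exists_index, forall_apply_eq_imp_iff]
        intro i
        refine orderOf_eq_prime ?_ fun h ↦ ?_
        · rw [pow_two, ← map_mul, hsq, map_one]
        · exact hne i (graphSubgroup_le_range X ((QuotientGroup.eq_one_iff _).1 h))
      gen := by simpa using ht_gen X }
  let c (X) : Quotient (involGenSetoid (Fintype.card I) m) := Quotient.mk _ (A X)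
  have φ (X) : (A X).G ≃* (c X).out.G := 
    Classical.choice ((involGenSetoid _ m).symm (Quotient.mk_out (A X)))
  have hfin (A : InvolGenGroup (Fintype.card I) m) : Finite A.G :=
    Nat.finite_of_card_ne_zero (by rw [A.card_eq]; positivity)
  have e (A : InvolGenGroup (Fintype.card I) m) : A.G ≃ Fin (2 ^ m) :=
    Finite.equivFinOfCardEq A.card_eq
  let f (X) : Quotient (involGenSetoid (Fintype.card I) m) × (I → Fin (2 ^ m)) :=
    (c X, fun i ↦ e _ (φ X (t X i)))
  have hf : Function.Injective f := by
    intro X Y h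
    have key : ∀ q q' : Quotient (involGenSetoid (Fintype.card I) m), q = q' →
        ∀ (ψ : P →* q.out.G) (ψ' : P →* q'.out.G),
          (∀ i, e _ (ψ (T i)) = e _ (ψ' (T i))) → ψ.ker = ψ'.ker := by
      rintro q _ rfl ψ ψ' hψ
      rw [MonoidHom.eq_of_eqOn_dense hT (f := ψ) (g := ψ')]
      rintro _ ⟨i, rfl⟩
      exact (e _).injective (hψ i)
    have hker (X) : ((φ X).toMonoidHom.comp (QuotientGroup.mk' (graphSubgroup ι X))).ker =
        graphSubgroup ι X := by
      ext g
      rw [MonoidHom.mem_ker, ← QuotientGroup.eq_one_iff]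
      exact (φ X).map_eq_one_iff
    refine graphSubgroup_injective hι ?_
    rw [← hker X, ← hker Y]
    exact key _ _ (congrArg Prod.fst h) _ _ fun i ↦ congrFun (congrArg Prod.snd h) i
  have := Nat.card_le_card_of_injective f hf
  rw [Nat.card_prod, Nat.card_fun] at this
  simpa [Matrix, gCount, ← pow_mul, mul_comm] using this

/-- An additive character `χ : ZMod q → K` together with an endomorphism of `K` inverting its
values. -/
structure UnitaryChar (K : Type) [CommRing K] (q : ℕ) where
  χ : AddChar (ZMod q) K
  bar : K →+* K
  χ_mul_bar (i : ZMod q) : χ i * bar (χ i) = 1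

namespace UnitaryChar

variable {K : Type} [CommRing K] {q : ℕ} (C : UnitaryChar K q) {e : ℕ}

theorem χ_mul_χ_neg (i : ZMod q) : C.χ i * C.χ (-i) = 1 := by
  rw [← AddChar.map_add_eq_mul, add_neg_cancel, AddChar.map_zero_eq_one]

/-- A biadditive matrix-valued pairing on `(K × K)ᵉ`. -/
def pairing (v w : Fin e → K × K) : Matrix (Fin e) (Fin e) K := fun i k ↦
  if i = k then (v i).1 * (w k).2
  else if i < k then (v i).1 * (w k).2 + (v i).2 * (w k).1
  else (v i).1 * C.bar (w k).1 + (v i).2 * C.bar (w k).2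

theorem pairing_add_left (v v' w : Fin e → K × K) :
    C.pairing (v + v') w = C.pairing v w + C.pairing v' w := by
  ext i k
  simp only [pairing, Pi.add_apply, Prod.fst_add, Prod.snd_add, Matrix.add_apply]
  split_ifs <;> ring

theorem pairing_add_right (v w w' : Fin e → K × K) :
    C.pairing v (w + w') = C.pairing v w + C.pairing v w' := by
  ext i k
  simp only [pairing, Pi.add_apply, Prod.fst_add, Prod.snd_add, Matrix.add_apply, map_add]
  split_ifs <;> ring

@[simp]
theorem pairing_zero_left (w : Fin e → K × K) : C.pairing 0 w = 0 := by
  simpa using C.pairing_add_left 0 0 w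

@[simp]
theorem pairing_zero_right (v : Fin e → K × K) : C.pairing v 0 = 0 := by
  simpa using C.pairing_add_right v 0 0

theorem pairing_neg_left (v w : Fin e → K × K) : C.pairing (-v) w = -C.pairing v w := by
  rw [eq_neg_iff_add_eq_zero, ← pairing_add_left, neg_add_cancel, pairing_zero_left]

theorem pairing_single (i k : Fin e) (x y : K × K) :
    C.pairing (Pi.single i x) (Pi.single k y) = Matrix.single i k
      (if i = k then x.1 * y.2 else if i < k then x.1 * y.2 + x.2 * y.1
        else x.1 * C.bar y.1 + x.2 * C.bar y.2) := by
  ext i' k'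
  by_cases hi : i = i'
  · by_cases hk : k = k'
    · subst hi hk
      simp [pairing]
    · subst hi
      simp [pairing, Matrix.single_apply_of_col_ne _ _ hk, Pi.single_eq_of_ne (Ne.symm hk)]
  · simp [pairing, Matrix.single_apply_of_row_ne hi, Pi.single_eq_of_ne (Ne.symm hi)]

theorem exists_pairing_sub_pairing_eq_single (i k : Fin e) (a : K) : ∃ v w : Fin e → K × K,
    C.pairing v w - C.pairing w v = Matrix.single i k a := by
  refine ⟨Pi.single i (a, 0), Pi.single k (if k < i then (1, 0) else (0, 1)), ?_⟩
  rw [pairing_single, pairing_single]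
  rcases lt_trichotomy i k with h | rfl | h
  · simp [h, h.ne, h.ne', h.not_gt]
  · simp
  · simp [h, h.ne, h.ne', h.not_gt]

/-- The central extension of `(K × K)ᵉ` by `Matrix (Fin e) (Fin e) K` with cocycle `pairing`. -/
@[ext]
structure Ext (C : UnitaryChar K q) (e : ℕ) where
  v : Fin e → K × K
  z : Matrix (Fin e) (Fin e) K

namespace Ext

instance : One (C.Ext e) := ⟨⟨0, 0⟩⟩
instance : Mul (C.Ext e) := ⟨fun n n' ↦ ⟨n.v + n'.v, n.z + n'.z + C.pairing n.v n'.v⟩⟩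
instance : Inv (C.Ext e) := ⟨fun n ↦ ⟨-n.v, -n.z + C.pairing n.v n.v⟩⟩

variable {C}

@[simp] theorem one_v : (1 : C.Ext e).v = 0 := rfl
@[simp] theorem one_z : (1 : C.Ext e).z = 0 := rfl
@[simp] theorem mul_v (n n' : C.Ext e) : (n * n').v = n.v + n'.v := rfl
@[simp] theorem mul_z (n n' : C.Ext e) :
    (n * n').z = n.z + n'.z + C.pairing n.v n'.v := rfl
@[simp] theorem inv_v (n : C.Ext e) : n⁻¹.v = -n.v := rfl
@[simp] theorem inv_z (n : C.Ext e) : n⁻¹.z = -n.z + C.pairing n.v n.v := rfl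

instance : Group (C.Ext e) := Group.ofLeftAxioms
  (fun a b c ↦ Ext.ext (by simp [add_assoc]) (by
    simp only [mul_z, mul_v, pairing_add_left, pairing_add_right]; abel))
  (fun a ↦ Ext.ext (by simp) (by simp))
  (fun a ↦ Ext.ext (by simp) (by simp [pairing_neg_left]))

variable (C e) in
def equivProd : C.Ext e ≃ (Fin e → K × K) × Matrix (Fin e) (Fin e) K where
  toFun n := (n.v, n.z)
  invFun n := ⟨n.1, n.2⟩

/-- The rotations act diagonally on `(K × K)ᵉ` and fix the centre; a reflection swaps
the two coordinates, up to a quadratic correction. -/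
instance : SMul (DihedralGroup q) (C.Ext e) where
  smul
    | .r i, n => ⟨fun k ↦ (C.χ i * (n.v k).1, C.χ (-i) * (n.v k).2), n.z⟩
    | .sr i, n => ⟨fun k ↦ (C.χ (-i) * (n.v k).2, C.χ i * (n.v k).1),
        n.z + .diagonal fun k ↦ (n.v k).1 * (n.v k).2⟩

theorem r_smul (i : ZMod q) (n : C.Ext e) : DihedralGroup.r i • n =
    ⟨fun k ↦ (C.χ i * (n.v k).1, C.χ (-i) * (n.v k).2), n.z⟩ := rfl

theorem sr_smul (i : ZMod q) (n : C.Ext e) : DihedralGroup.sr i • n =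
    ⟨fun k ↦ (C.χ (-i) * (n.v k).2, C.χ i * (n.v k).1),
      n.z + .diagonal fun k ↦ (n.v k).1 * (n.v k).2⟩ := rfl

theorem smul_mk_zero (g : DihedralGroup q) (z : Matrix (Fin e) (Fin e) K) :
    g • (⟨0, z⟩ : C.Ext e) = ⟨0, z⟩ := by
  cases g <;> simp [r_smul, sr_smul] <;> rfl

theorem r_mul_smul (i : ZMod q) (h : DihedralGroup q) (n : C.Ext e) :
    (DihedralGroup.r i * h) • n = DihedralGroup.r i • h • n := by
  rcases h with j | j
  · simp only [DihedralGroup.r_mul_r, r_smul, neg_add, AddChar.map_add_eq_mul, mul_assoc]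
  · simp only [DihedralGroup.r_mul_sr, r_smul, sr_smul, sub_eq_add_neg, neg_add, neg_neg,
      AddChar.map_add_eq_mul, Ext.mk.injEq, and_true]
    ext k <;> simp <;> ring

theorem sr_mul_smul [CharP K 2] (i : ZMod q) (h : DihedralGroup q) (n : C.Ext e) :
    (DihedralGroup.sr i * h) • n = DihedralGroup.sr i • h • n := by
  rcases h with j | j
  · simp only [DihedralGroup.sr_mul_r, r_smul, sr_smul, neg_add, AddChar.map_add_eq_mul,
      Ext.mk.injEq, add_right_inj]
    refine ⟨by ext k <;> simp <;> ring, congrArg _ (funext fun k ↦ ?_)⟩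
    linear_combination -((n.v k).1 * (n.v k).2) * C.χ_mul_χ_neg j
  · simp only [DihedralGroup.sr_mul_sr, r_smul, sr_smul, sub_eq_add_neg, neg_add, neg_neg,
      AddChar.map_add_eq_mul, Ext.mk.injEq, add_assoc, Matrix.diagonal_add]
    refine ⟨by ext k <;> simp <;> ring, left_eq_add.2 (Matrix.diagonal_eq_zero.2 (funext fun k ↦ ?_))⟩
    simp only [Pi.zero_apply]
    linear_combination (n.v k).1 * (n.v k).2 * C.χ_mul_χ_neg j +
      (n.v k).1 * (n.v k).2 * CharTwo.two_eq_zero (R := K)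

theorem r_smul_mul (i : ZMod q) (n n' : C.Ext e) :
    DihedralGroup.r i • (n * n') = DihedralGroup.r i • n * DihedralGroup.r i • n' := by
  ext k l
  · simp [r_smul, mul_add]
  · simp [r_smul, mul_add]
  · have h := C.χ_mul_χ_neg i
    have h₁ := C.χ_mul_bar i
    have h₂ := C.χ_mul_bar (-i)
    simp only [r_smul, mul_z, Matrix.add_apply, pairing, map_mul, add_right_inj]
    split_ifs
    · linear_combination -((n.v k).1 * (n'.v l).2) * h
    · linear_combination -((n.v k).1 * (n'.v l).2 + (n.v k).2 * (n'.v l).1) * h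
    · linear_combination -((n.v k).1 * C.bar (n'.v l).1) * h₁ - (n.v k).2 * C.bar (n'.v l).2 * h₂

theorem sr_smul_mul [CharP K 2] (i : ZMod q) (n n' : C.Ext e) :
    DihedralGroup.sr i • (n * n') = DihedralGroup.sr i • n * DihedralGroup.sr i • n' := by
  ext k l
  · simp [sr_smul, mul_add]
  · simp [sr_smul, mul_add]
  · have h := C.χ_mul_χ_neg i
    have h₁ := C.χ_mul_bar i
    have h₂ := C.χ_mul_bar (-i)
    simp only [sr_smul, mul_z, mul_v, Matrix.add_apply, pairing, map_mul, Pi.add_apply,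
      Prod.fst_add, Prod.snd_add, Matrix.diagonal_apply]
    split_ifs
    · subst l
      linear_combination -((n.v k).2 * (n'.v k).1) * h +
        (n.v k).1 * (n'.v k).2 * CharTwo.two_eq_zero (R := K)
    · linear_combination -((n.v k).1 * (n'.v l).2 + (n.v k).2 * (n'.v l).1) * h
    · linear_combination -((n.v k).1 * C.bar (n'.v l).1) * h₁ - (n.v k).2 * C.bar (n'.v l).2 * h₂

variable [CharP K 2]

instance : MulDistribMulAction (DihedralGroup q) (C.Ext e) where
  one_smul n := by
    rw [DihedralGroup.one_def, r_smul]
    simp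
  mul_smul
    | .r i, h, n => r_mul_smul i h n
    | .sr i, h, n => sr_mul_smul i h n
  smul_mul
    | .r i, n, n' => r_smul_mul i n n'
    | .sr i, n, n' => sr_smul_mul i n n'
  smul_one g := smul_mk_zero g 0

end Ext

variable [CharP K 2]

/-- The semidirect product of the central extension `C.Ext e` with the dihedral group. -/
abbrev BigGroup (C : UnitaryChar K q) (e : ℕ) : Type :=
  C.Ext e ⋊[MulDistribMulAction.toMulAut (DihedralGroup q) (C.Ext e)] DihedralGroup q

variable (e) in
/-- The embedding of the centre of `C.Ext e`. -/
def matrixHom : Multiplicative (Matrix (Fin e) (Fin e) K) →* C.BigGroup e :=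
  SemidirectProduct.inl.comp
    { toFun z := ⟨0, z.toAdd⟩
      map_one' := rfl
      map_mul' z z' := by ext <;> simp }

theorem matrixHom_apply (z : Matrix (Fin e) (Fin e) K) :
    C.matrixHom e (Multiplicative.ofAdd z) = SemidirectProduct.inl ⟨0, z⟩ := rfl

theorem matrixHom_injective : Function.Injective (C.matrixHom e) := fun _ _ h ↦
  congrArg Ext.z (SemidirectProduct.inl_injective h)

theorem matrixHom_mem_center (z : Multiplicative (Matrix (Fin e) (Fin e) K)) :
    C.matrixHom e z ∈ Subgroup.center (C.BigGroup e) := by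
  rw [Subgroup.mem_center_iff]
  intro g
  have h := Ext.smul_mk_zero (C := C) g.right z.toAdd
  refine SemidirectProduct.ext ?_ (by simp [matrixHom])
  ext <;> simp [matrixHom, h, add_comm]

theorem mem_range_matrixHom {g : C.BigGroup e} :
    g ∈ (C.matrixHom e).range ↔ g.left.v = 0 ∧ g.right = 1 := by
  constructor
  · rintro ⟨z, rfl⟩
    exact ⟨rfl, rfl⟩
  · rintro ⟨h₁, h₂⟩
    refine ⟨Multiplicative.ofAdd g.left.z, SemidirectProduct.ext (Ext.ext h₁.symm rfl) h₂.symm⟩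

/-- The `e + 2` generating involutions of `C.BigGroup e`. -/
def gens (C : UnitaryChar K q) (e : ℕ) : Bool ⊕ Fin e → C.BigGroup e
  | .inl b => SemidirectProduct.inr (.sr (if b then 1 else 0))
  | .inr k => SemidirectProduct.inl ⟨Pi.single k (1, 0), 0⟩

theorem gens_mul_self (i : Bool ⊕ Fin e) : C.gens e i * C.gens e i = 1 := by
  rcases i with b | k
  · rw [gens, ← map_mul, DihedralGroup.sr_mul_self, map_one]
  · rw [gens, ← map_mul]
    suffices (⟨Pi.single k (1, 0), 0⟩ * ⟨Pi.single k (1, 0), 0⟩ : C.Ext e) = 1 by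
      rw [this, map_one]
    refine Ext.ext ?_ ?_
    · simp [← Pi.single_add, CharTwo.add_self_eq_zero]
    · simp [pairing_single]

theorem gens_notMem_range [Nontrivial K] (i : Bool ⊕ Fin e) :
    C.gens e i ∉ (C.matrixHom e).range := by
  rw [mem_range_matrixHom]
  rcases i with b | k
  · rintro ⟨-, h⟩
    simp [gens, DihedralGroup.one_def, -DihedralGroup.r_zero] at h
  · rintro ⟨h, -⟩
    simpa [gens] using congrFun h k

theorem eq_of_gens_inv_mul_mem_range [Nontrivial K] (hq : 1 < q) (i i' : Bool ⊕ Fin e)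
    (h : (C.gens e i)⁻¹ * C.gens e i' ∈ (C.matrixHom e).range) : i = i' := by
  have : Fact (1 < q) := ⟨hq⟩
  obtain ⟨h₁, h₂⟩ := C.mem_range_matrixHom.1 h
  rcases i with b | k <;> rcases i' with b' | k'
  · cases b <;> cases b' <;> simp_all [gens, DihedralGroup.one_def, -DihedralGroup.r_zero]
  · simp [gens, DihedralGroup.one_def, -DihedralGroup.r_zero] at h₂
  · simp [gens, DihedralGroup.one_def, -DihedralGroup.r_zero] at h₂
  · by_contra hne
    have hne' : k ≠ k' := fun h ↦ hne (h ▸ rfl)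
    have := congrArg Prod.fst (congrFun h₁ k)
    simp [gens, hne'] at this

theorem inr_mem_closure_gens [NeZero q] (g : DihedralGroup q) :
    SemidirectProduct.inr g ∈ Subgroup.closure (Set.range (C.gens e)) := by
  set H := Subgroup.closure (Set.range (C.gens e))
  have hs (b : Bool) : SemidirectProduct.inr (.sr (if b then 1 else 0)) ∈ H :=
    Subgroup.subset_closure ⟨.inl b, rfl⟩
  have hr (i : ZMod q) : SemidirectProduct.inr (.r i) ∈ H := by
    have h₁ : SemidirectProduct.inr (.r 1) ∈ H := by
      simpa [← map_mul] using H.mul_mem (hs false) (hs true)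
    simpa [← map_pow] using H.pow_mem h₁ i.val
  rcases g with i | i
  · exact hr i
  · simpa [← map_mul] using H.mul_mem (hs false) (hr i)

theorem closure_gens [NeZero q] (hχ : AddSubgroup.closure (Set.range C.χ) = ⊤) :
    Subgroup.closure (Set.range (C.gens e)) = ⊤ := by
  set H := Subgroup.closure (Set.range (C.gens e)) with hH
  have hinr (g : DihedralGroup q) : SemidirectProduct.inr g ∈ H := C.inr_mem_closure_gens g
  let N : Subgroup (C.Ext e) := H.comap SemidirectProduct.inl
  have hsmul (g : DihedralGroup q) {n : C.Ext e} (hn : n ∈ N) : g • n ∈ N := by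
    have h := H.mul_mem (H.mul_mem (hinr g) hn) (H.inv_mem (hinr g))
    rw [← map_inv, ← SemidirectProduct.inl_aut] at h
    exact h
  let A : AddSubgroup (Fin e → K × K) :=
    { carrier := {v | ∃ z, (⟨v, z⟩ : C.Ext e) ∈ N}
      zero_mem' := ⟨0, N.one_mem⟩
      add_mem' := fun ⟨_, h⟩ ⟨_, h'⟩ ↦ ⟨_, N.mul_mem h h'⟩
      neg_mem' := fun ⟨_, h⟩ ↦ ⟨_, N.inv_mem h⟩ }
  have hmem {n : C.Ext e} (hn : n ∈ N) {v} (hv : n.v = v) : v ∈ A := ⟨n.z, hv ▸ hn⟩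
  have hbase (k : Fin e) : (⟨Pi.single k (1, 0), 0⟩ : C.Ext e) ∈ N :=
    Subgroup.subset_closure ⟨.inr k, rfl⟩
  have hfst (k : Fin e) (a : K) : Pi.single k (a, 0) ∈ A := by
    suffices h : ⊤ ≤ A.comap ((AddMonoidHom.single (fun _ : Fin e ↦ K × K) k).comp
        (AddMonoidHom.inl K K)) from h (AddSubgroup.mem_top a)
    rw [← hχ, AddSubgroup.closure_le]
    rintro _ ⟨i, rfl⟩
    refine hmem (hsmul (.r i) (hbase k)) (funext fun l ↦ ?_)
    rcases eq_or_ne l k with rfl | h <;> simp [Ext.r_smul, *]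
  have hsnd (k : Fin e) (a : K) : Pi.single k (0, a) ∈ A := by
    obtain ⟨z, hz⟩ := hfst k a
    refine hmem (hsmul (.sr 0) hz) (funext fun l ↦ ?_)
    rcases eq_or_ne l k with rfl | h <;> simp [Ext.sr_smul, *]
  have hA (v : Fin e → K × K) : v ∈ A := by
    rw [← Finset.univ_sum_single v]
    refine sum_mem fun k _ ↦ ?_
    have := A.add_mem (hfst k (v k).1) (hsnd k (v k).2)
    rwa [← Pi.single_add, Prod.mk_add_mk, add_zero, zero_add] at this
  let Z : AddSubgroup (Matrix (Fin e) (Fin e) K) :=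
    { carrier := {z | (⟨0, z⟩ : C.Ext e) ∈ N}
      zero_mem' := N.one_mem
      add_mem' := fun {z z'} h h' ↦ by
        have : (⟨0, z + z'⟩ : C.Ext e) = ⟨0, z⟩ * ⟨0, z'⟩ := by ext <;> simp
        exact (congrArg (· ∈ N) this).mpr (N.mul_mem h h')
      neg_mem' := fun {z} h ↦ by
        have : (⟨0, -z⟩ : C.Ext e) = ⟨0, z⟩⁻¹ := by ext <;> simp
        exact (congrArg (· ∈ N) this).mpr (N.inv_mem h) }
  have hcomm (v w : Fin e → K × K) : C.pairing v w - C.pairing w v ∈ Z := by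
    obtain ⟨z, hz⟩ := hA v
    obtain ⟨z', hz'⟩ := hA w
    have : (⟨0, C.pairing v w - C.pairing w v⟩ : C.Ext e) =
        ⟨v, z⟩ * ⟨w, z'⟩ * (⟨w, z'⟩ * ⟨v, z⟩)⁻¹ := by
      rw [eq_mul_inv_iff_mul_eq]
      refine Ext.ext (by simp [add_comm]) ?_
      simp only [Ext.mul_z, Ext.mul_v, pairing_zero_left]
      abel
    exact (congrArg (· ∈ N) this).mpr
      (N.mul_mem (N.mul_mem hz hz') (N.inv_mem (N.mul_mem hz' hz)))
  have hZ (z : Matrix (Fin e) (Fin e) K) : z ∈ Z := by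
    rw [Matrix.matrix_eq_sum_single z]
    refine sum_mem fun i _ ↦ sum_mem fun k _ ↦ ?_
    obtain ⟨v, w, h⟩ := C.exists_pairing_sub_pairing_eq_single i k (z i k)
    exact h ▸ hcomm v w
  refine (Subgroup.eq_top_iff' _).2 fun g ↦ ?_
  rw [← SemidirectProduct.inl_left_mul_inr_right g]
  refine H.mul_mem ?_ (hinr _)
  obtain ⟨z, hz⟩ := hA g.left.v
  have h := N.mul_mem (hZ (g.left.z - z)) hz
  convert show SemidirectProduct.inl _ ∈ H from h
  ext <;> simp

end UnitaryChar

open Polynomial in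
/-- The truncated polynomial ring `𝔽₂[r] / (r ^ p)` carries a unitary character sending `1` to
`1 + r`. -/
theorem UnitaryChar.exists_finrank_eq {p k : ℕ} (hp : 0 < p) (hk : p ≤ 2 ^ k) :
    ∃ (K : Type) (_ : CommRing K) (_ : Algebra (ZMod 2) K) (C : UnitaryChar K (2 ^ k)),
      Module.Finite (ZMod 2) K ∧ Module.finrank (ZMod 2) K = p ∧ CharP K 2 ∧
      AddSubgroup.closure (Set.range C.χ) = ⊤ := by
  have hmonic : (X ^ p : (ZMod 2)[X]).Monic := monic_X_pow p
  let pb := AdjoinRoot.powerBasis' hmonic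
  have hfinrank : Module.finrank (ZMod 2) (AdjoinRoot (X ^ p : (ZMod 2)[X])) = p := by
    rw [pb.finrank, AdjoinRoot.powerBasis'_dim, natDegree_X_pow]
  have hnt : Nontrivial (AdjoinRoot (X ^ p : (ZMod 2)[X])) :=
    Module.nontrivial_of_finrank_pos (R := ZMod 2) (by omega)
  have hchar : CharP (AdjoinRoot (X ^ p : (ZMod 2)[X])) 2 :=
    charP_of_injective_algebraMap (algebraMap (ZMod 2) _).injective 2
  set r := AdjoinRoot.root (X ^ p : (ZMod 2)[X]) with hr_def
  have hr : r ^ p = 0 := by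
    have := AdjoinRoot.eval₂_root (X ^ p : (ZMod 2)[X])
    simpa using this
  have hu : (1 + r) ^ 2 ^ k = 1 := by
    rw [add_pow_char_pow, one_pow, pow_eq_zero_of_le hk hr, add_zero]
  have hinv : ((1 + r) ^ (2 ^ k - 1) - 1) ^ p = 0 := by
    have h := sub_dvd_pow_sub_pow (1 + r) 1 (2 ^ k - 1)
    rw [one_pow, add_sub_cancel_left] at h
    exact zero_dvd_iff.1 (hr ▸ pow_dvd_pow_of_dvd h p)
  let bar : AdjoinRoot (X ^ p : (ZMod 2)[X]) →+* AdjoinRoot (X ^ p : (ZMod 2)[X]) :=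
    AdjoinRoot.lift (algebraMap _ _) ((1 + r) ^ (2 ^ k - 1) - 1) (by simpa using hinv)
  have hbar : bar (1 + r) = (1 + r) ^ (2 ^ k - 1) := by
    simp [bar, hr_def]
  refine ⟨AdjoinRoot (X ^ p : (ZMod 2)[X]), inferInstance, inferInstance,
    ⟨AddChar.zmodChar (2 ^ k) hu, bar, fun i ↦ ?_⟩, pb.finite, hfinrank, hchar, ?_⟩
  · rw [AddChar.zmodChar_apply, map_pow, hbar, ← mul_pow, ← pow_succ',
      Nat.sub_add_cancel Nat.one_le_two_pow, hu, one_pow]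
  · set S := AddSubgroup.closure (Set.range (AddChar.zmodChar (2 ^ k) hu))
    have hadjoin : Algebra.adjoin (ZMod 2) {1 + r} = ⊤ := by
      rw [eq_top_iff, ← AdjoinRoot.adjoinRoot_eq_top, Algebra.adjoin_le_iff,
        Set.singleton_subset_iff]
      have := sub_mem (Algebra.self_mem_adjoin_singleton (ZMod 2) (1 + r)) (one_mem _)
      rwa [add_sub_cancel_left] at this
    have hspan := congrArg Subalgebra.toSubmodule hadjoin
    rw [Algebra.adjoin_eq_span, Algebra.top_toSubmodule] at hspan
    suffices h : ⊤ ≤ AddSubgroup.toZModSubmodule 2 S from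
      (AddSubgroup.eq_top_iff' _).2 fun x ↦ h (Submodule.mem_top (x := x))
    rw [← hspan, Submodule.span_le]
    intro x hx
    obtain ⟨n, rfl⟩ := Submonoid.mem_closure_singleton.1 hx
    exact AddSubgroup.subset_closure ⟨n, AddChar.zmodChar_apply' hu n⟩

theorem two_pow_le_gCount_mul_two_pow {e p k a j : ℕ} (hp : 0 < p) (hk₀ : 0 < k) (hk : p ≤ 2 ^ k)
    (haj : a + j = e * e * p) :
    2 ^ (j * a) ≤ gCount (e + 2) (1 + k + 2 * e * p + j) *
      2 ^ ((e + 2) * (1 + k + 2 * e * p + j)) := by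
  obtain ⟨K, _, _, C, _, hfinrank, hchar, hχ⟩ := UnitaryChar.exists_finrank_eq hp hk
  have hnt : Nontrivial K := CharP.nontrivial_of_char_ne_one (v := 2) (by norm_num)
  have hrank : Module.finrank (ZMod 2) ((Fin a → ZMod 2) × (Fin j → ZMod 2)) =
      Module.finrank (ZMod 2) (Matrix (Fin e) (Fin e) K) := by
    simp [Module.finrank_matrix, hfinrank, haj]
  let E := LinearEquiv.ofFinrankEq _ _ hrank
  let ι := (C.matrixHom e).comp (AddMonoidHom.toMultiplicative E.toLinearMap.toAddMonoidHom)
  have hrange : ι.range = (C.matrixHom e).range := by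
    rw [MonoidHom.range_comp, MonoidHom.range_eq_map (C.matrixHom e)]
    exact congrArg _ (MonoidHom.range_eq_top.2 E.surjective)
  have hK : Nat.card K = 2 ^ p := by
    rw [Module.natCard_eq_pow_finrank (K := ZMod 2), hfinrank, Nat.card_zmod]
  have hq : 1 < 2 ^ k := Nat.one_lt_two_pow hk₀.ne'
  have hcard : Nat.card (C.BigGroup e) = 2 ^ (1 + k + 2 * e * p + j + a) := by
    rw [SemidirectProduct.card, Nat.card_congr (UnitaryChar.Ext.equivProd C e), Nat.card_prod,
      DihedralGroup.nat_card, Nat.card_fun, Nat.card_prod, hK, Matrix, Nat.card_fun, Nat.card_fun, hK]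
    have he : 1 + k + 2 * e * p + j + a = p * 2 * e + p * e * e + (1 + k) := by linarith
    rw [he]
    simp only [Nat.card_fin, ← pow_mul, ← pow_add, ← pow_succ', ← two_mul]
    ring
  have h := two_pow_le_gCount_mul (C.gens e) ι
    (C.matrixHom_injective.comp E.injective) (fun z ↦ C.matrixHom_mem_center _) hcard
    (C.closure_gens hχ) C.gens_mul_self (fun i ↦ hrange ▸ C.gens_notMem_range i)
    (fun i i' ↦ hrange ▸ C.eq_of_gens_inv_mul_mem_range hq i i')
  simpa [add_comm 2, ← pow_mul, mul_comm] using h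

theorem tendsto_natLog_div_atTop (b : ℕ) :
    Filter.Tendsto (fun m : ℕ ↦ (Nat.log b m : ℝ) / m) .atTop (nhds 0) := by
  have h : Filter.Tendsto (fun m : ℕ ↦ Real.logb b m / m) .atTop (nhds 0) := by
    have := (Real.isLittleO_log_id_atTop.tendsto_div_nhds_zero.comp
      tendsto_natCast_atTop_atTop).div_const (Real.log b)
    rw [zero_div] at this
    refine this.congr fun m ↦ ?_
    simp only [Function.comp_apply, id_eq, Real.logb]
    ring
  refine squeeze_zero (fun m ↦ by positivity) (fun m ↦ ?_) h
  gcongr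
  exact Real.natLog_le_logb m b

/-- For every `d ≥ 3` and `ε > 0`, for all sufficiently large `m`,
`g_d(m) ≥ 2^(((d−2)²/(8d) − ε)·m²)`. -/
theorem gCount_lower_bound (d : ℕ) (hd : 3 ≤ d) (ε : ℝ) (hε : 0 < ε) :
    ∃ m₀ : ℕ, ∀ m : ℕ, m₀ ≤ m →
      2 ^ ((((d : ℝ) - 2) ^ 2 / (8 * (d : ℝ)) - ε) * (m : ℝ) ^ 2) ≤ (gCount d m : ℝ) := by
  obtain ⟨e, rfl⟩ : ∃ e, d = e + 2 := ⟨d - 2, by omega⟩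
  have he : (1 : ℝ) ≤ e := by exact_mod_cast (by omega : 1 ≤ e)
  set β : ℝ := ((e : ℝ) + 4) / (4 * (e + 2) * e) with hβ
  have hβ₀ : 0 < β := by positivity
  have hβ₁ : β ≤ 1 := (div_le_one₀ (by positivity)).2 (by nlinarith)
  let p (m : ℕ) : ℕ := ⌊β * m⌋₊
  let k (m : ℕ) : ℕ := Nat.log 2 m + 1
  let J (m : ℕ) : ℝ := m - (1 + k m + 2 * e * p m)
  let A (m : ℕ) : ℝ := e * e * p m - J m
  have hinv : Filter.Tendsto (fun m : ℕ ↦ (1 : ℝ) / m) .atTop (nhds 0) :=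
    tendsto_one_div_atTop_nhds_zero_nat
  have hp_lim : Filter.Tendsto (fun m : ℕ ↦ (p m : ℝ) / m) .atTop (nhds β) :=
    (tendsto_nat_floor_mul_div_atTop hβ₀.le).comp tendsto_natCast_atTop_atTop
  have hJ_lim : Filter.Tendsto (fun m ↦ J m / m) .atTop (nhds (e / (2 * (e + 2)))) := by
    have h := (((tendsto_natLog_div_atTop 2).add (hinv.const_mul 2)).add
      (hp_lim.const_mul (2 * (e : ℝ)))).const_sub 1
    have hlim : 1 - (0 + 2 * 0 + 2 * (e : ℝ) * β) = e / (2 * (e + 2)) := by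
      rw [hβ]; field_simp; ring
    rw [hlim] at h
    refine h.congr' ?_
    filter_upwards [Filter.eventually_gt_atTop 0] with m hm
    have : (m : ℝ) ≠ 0 := by positivity
    simp only [J, k]
    push_cast
    field_simp
    ring
  have hA_lim : Filter.Tendsto (fun m ↦ A m / m) .atTop (nhds (e / 4)) := by
    have h := (hp_lim.const_mul ((e : ℝ) * e)).sub hJ_lim
    have hlim : (e : ℝ) * e * β - e / (2 * (e + 2)) = e / 4 := by
      rw [hβ]; field_simp; ring
    rw [hlim] at h
    refine h.congr fun m ↦ ?_
    simp only [A]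
    ring
  have hmain : Filter.Tendsto (fun m : ℕ ↦ J m / m * (A m / m) - (e + 2) * (1 / m)) .atTop
      (nhds ((e : ℝ) ^ 2 / (8 * (e + 2)))) := by
    have h := (hJ_lim.mul hA_lim).sub (hinv.const_mul ((e : ℝ) + 2))
    have hlim : (e : ℝ) / (2 * (e + 2)) * (e / 4) - (e + 2) * 0 = e ^ 2 / (8 * (e + 2)) := by
      field_simp; ring
    rwa [hlim] at h
  obtain ⟨m₀, hm₀⟩ := Filter.eventually_atTop.1
    ((hp_lim.eventually_const_lt hβ₀).and <|
      (hJ_lim.eventually_const_lt (show (0 : ℝ) < e / (2 * (e + 2)) by positivity)).and <|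
      (hA_lim.eventually_const_lt (show (0 : ℝ) < e / 4 by positivity)).and <|
      (hmain.eventually_const_lt (sub_lt_self _ hε)).and (Filter.eventually_gt_atTop 0))
  refine ⟨m₀, fun m hm ↦ ?_⟩
  obtain ⟨hp, hJ, hA, hlt, hm_pos⟩ := hm₀ m hm
  have hm_pos' : (0 : ℝ) < m := by exact_mod_cast hm_pos
  replace hp : 0 < p m := by exact_mod_cast (div_pos_iff_of_pos_right hm_pos').1 hp
  replace hJ : 0 < J m := (div_pos_iff_of_pos_right hm_pos').1 hJ
  replace hA : 0 < A m := (div_pos_iff_of_pos_right hm_pos').1 hA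
  have hpm : p m ≤ 2 ^ k m := by
    have h₁ : p m ≤ m := Nat.floor_le_of_le (mul_le_of_le_one_left hm_pos'.le hβ₁)
    exact h₁.trans (Nat.lt_pow_succ_log_self one_lt_two m).le
  obtain ⟨j, hj⟩ : ∃ j, m = 1 + k m + 2 * e * p m + j := by
    refine Nat.exists_eq_add_of_le ?_
    have : ((1 + k m + 2 * e * p m : ℕ) : ℝ) ≤ m := by push_cast; exact (sub_pos.1 hJ).le
    exact_mod_cast this
  have hjJ : (j : ℝ) = J m := by
    have : (m : ℝ) = 1 + k m + 2 * e * p m + j := by exact_mod_cast hj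
    simp only [J]
    linarith
  obtain ⟨a, ha⟩ : ∃ a, e * e * p m = j + a := by
    refine Nat.exists_eq_add_of_le ?_
    have : (j : ℝ) ≤ ((e * e * p m : ℕ) : ℝ) := by
      push_cast
      rw [hjJ]
      exact (sub_pos.1 hA).le
    exact_mod_cast this
  have haA : (a : ℝ) = A m := by
    have : (e : ℝ) * e * p m = j + a := by exact_mod_cast ha
    simp only [A]
    linarith
  have hcount := two_pow_le_gCount_mul_two_pow hp (Nat.succ_pos _) hpm
    ((add_comm a j).trans ha.symm)
  rw [← hj] at hcount
  have hcount' : (2 : ℝ) ^ ((j * a : ℕ) : ℝ) ≤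
      gCount (e + 2) m * (2 : ℝ) ^ (((e + 2) * m : ℕ) : ℝ) := by
    rw [Real.rpow_natCast, Real.rpow_natCast]
    exact_mod_cast hcount
  rw [← div_le_iff₀ (by positivity), ← Real.rpow_sub two_pos] at hcount'
  refine le_trans (Real.rpow_le_rpow_of_exponent_le one_le_two ?_) hcount'
  have h := mul_le_mul_of_nonneg_right hlt.le (sq_nonneg (m : ℝ))
  have hexp : (J m / m * (A m / m) - (e + 2) * (1 / m)) * (m : ℝ) ^ 2 =
      J m * A m - (e + 2) * m := by
    field_simp
  rw [hexp] at h
  push_cast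
  rw [hjJ, haA, add_sub_cancel_right]
  exact h
end

section
/- For every real ε > 0 there exists m₀ such that for all integers m ≥ m₀, the number of isomorphism classes of connected 3-valent graphical regular representations of order 2^m is at least 2^{(1/24 − ε)·m²}. -/
open SimpleGraph

/-- Finite graphs, presented as graphs on `Fin m` for some `m`. -/
def GSig := Σ m : ℕ, SimpleGraph (Fin m)

/-- Graphs satisfying `P`, up to isomorphism. -/
def graphSetoid (P : GSig → Prop) : Setoid {x : GSig // P x} where
  r a b := Nonempty (a.1.2 ≃g b.1.2)
  iseqv := ⟨fun _ => ⟨RelIso.refl _⟩, fun ⟨e⟩ => ⟨e.symm⟩, fun ⟨e⟩ ⟨f⟩ => ⟨e.trans f⟩⟩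

/-- The number of isomorphism classes of finite graphs satisfying `P`. -/
noncomputable def numIsoClasses (P : GSig → Prop) : ℕ :=
  Nat.card (Quotient (graphSetoid P))

/-- `Γ` is regular of valency `d`. -/
def DValent {V : Type*} (Γ : SimpleGraph V) (d : ℕ) : Prop :=
  ∀ v, (Γ.neighborSet v).ncard = d

/-- `Γ` is a graphical regular representation: its full automorphism group acts
regularly (sharply transitively) on the vertex set. -/
def IsGRR {V : Type*} (Γ : SimpleGraph V) : Prop :=
  ∀ u v : V, ∃! φ : Γ ≃g Γ, φ u = v

/-- Generators `a`, `b`, `c` of a group for which the edge colouring of the Cayley graph can be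
recovered from its short cycles: an edge lies in a 4-cycle iff its colour is `a` or `b`, and
`b` is told apart from `a` by closed walks of length 8 alternating with edges of colour `c`. -/
structure RigidTriple {G : Type*} [Group G] (a b c : G) : Prop where
  a_sq : a * a = 1
  b_sq : b * b = 1
  c_sq : c * c = 1
  comm : a * b = b * a
  bc_pow : b * c * b * c * b * c * b * c = 1
  closure_eq : Subgroup.closure {a, b, c} = ⊤
  a_ne_one : a ≠ 1
  b_ne_one : b ≠ 1
  c_ne_one : c ≠ 1
  a_ne_b : a ≠ b
  a_ne_c : a ≠ c
  b_ne_c : b ≠ c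
  four : ∀ u v, u = a ∨ u = b → v = a ∨ v = b → c * u * c * v ≠ 1
  eight : ∀ u v w, u = a ∨ u = b → v = a ∨ v = b → w = a ∨ w = b →
    a * c * u * c * v * c * w * c ≠ 1

/-- `uv` is an edge of `Γ` contained in a 4-cycle. -/
def SqEdge {V : Type*} (Γ : SimpleGraph V) (u v : V) : Prop :=
  Γ.Adj u v ∧ ∃ w x, Γ.Adj v w ∧ Γ.Adj w x ∧ Γ.Adj x u ∧ w ≠ u ∧ x ≠ v

/-- `uv` is an edge of `Γ` contained in no 4-cycle. -/
def NonSqEdge {V : Type*} (Γ : SimpleGraph V) (u v : V) : Prop :=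
  Γ.Adj u v ∧ ¬ SqEdge Γ u v

/-- `uv` is the first edge of a closed walk of length 8 whose edges alternate between those in
some 4-cycle and those in none. -/
def AltEdge {V : Type*} (Γ : SimpleGraph V) (u v : V) : Prop :=
  SqEdge Γ u v ∧ ∃ p q r s t w, NonSqEdge Γ v p ∧ SqEdge Γ p q ∧ NonSqEdge Γ q r ∧
    SqEdge Γ r s ∧ NonSqEdge Γ s t ∧ SqEdge Γ t w ∧ NonSqEdge Γ w u

section Iso

variable {V W : Type*} {Γ : SimpleGraph V} {Δ : SimpleGraph W}

lemma SqEdge.map (φ : Γ ≃g Δ) {u v : V} (h : SqEdge Γ u v) : SqEdge Δ (φ u) (φ v) := by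
  obtain ⟨h, w, x, h₁, h₂, h₃, h₄, h₅⟩ := h
  exact ⟨φ.map_adj_iff.2 h, φ w, φ x, φ.map_adj_iff.2 h₁, φ.map_adj_iff.2 h₂,
    φ.map_adj_iff.2 h₃, φ.injective.ne h₄, φ.injective.ne h₅⟩

lemma NonSqEdge.map (φ : Γ ≃g Δ) {u v : V} (h : NonSqEdge Γ u v) :
    NonSqEdge Δ (φ u) (φ v) :=
  ⟨φ.map_adj_iff.2 h.1, fun h' => h.2 (by simpa using h'.map φ.symm)⟩

lemma AltEdge.map (φ : Γ ≃g Δ) {u v : V} (h : AltEdge Γ u v) : AltEdge Δ (φ u) (φ v) := by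
  obtain ⟨h, p, q, r, s, t, w, h₁, h₂, h₃, h₄, h₅, h₆, h₇⟩ := h
  exact ⟨h.map φ, φ p, φ q, φ r, φ s, φ t, φ w, h₁.map φ, h₂.map φ, h₃.map φ, h₄.map φ,
    h₅.map φ, h₆.map φ, h₇.map φ⟩

lemma DValent.of_iso {d : ℕ} (φ : Γ ≃g Δ) (h : DValent Γ d) : DValent Δ d := by
  intro v
  rw [← h (φ.symm v)]
  simpa using (Set.ncard_congr' (φ.mapNeighborSet (φ.symm v))).symm

lemma IsGRR.of_iso (φ : Γ ≃g Δ) (h : IsGRR Γ) : IsGRR Δ := by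
  intro u v
  obtain ⟨ψ, hψ, huniq⟩ := h (φ.symm u) (φ.symm v)
  refine ⟨(φ.symm.trans ψ).trans φ, by simp [hψ], fun χ hχ => ?_⟩
  have := huniq ((φ.trans χ).trans φ.symm) (by simp [hχ])
  ext x
  simp [← this]

end Iso

namespace RigidTriple

variable {G : Type*} [Group G] {a b c : G}

lemma adj_iff (h : RigidTriple a b c) {g k : G} :
    (mulCayley {a, b, c}).Adj g k ↔ k = g * a ∨ k = g * b ∨ k = g * c := by
  have key : ∀ s : G, s * s = 1 → (g = k * s ↔ k = g * s) := fun s hs =>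
    ⟨fun e => by rw [e, mul_assoc, hs, mul_one], fun e => by rw [e, mul_assoc, hs, mul_one]⟩
  rw [mulCayley_adj']
  simp only [Set.mem_insert_iff, Set.mem_singleton_iff, exists_eq_or_imp, exists_eq_left,
    key a h.a_sq, key b h.b_sq, key c h.c_sq, eq_comm (b := k), or_self]
  refine and_iff_right_of_imp ?_
  rintro (rfl | rfl | rfl) <;> simp [h.a_ne_one, h.b_ne_one, h.c_ne_one]

lemma sqEdge_iff (h : RigidTriple a b c) {g k : G} :
    SqEdge (mulCayley {a, b, c}) g k ↔ k = g * a ∨ k = g * b := by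
  have haa : ∀ x, x * a * a = x := fun x => by rw [mul_assoc, h.a_sq, mul_one]
  have hbb : ∀ x, x * b * b = x := fun x => by rw [mul_assoc, h.b_sq, mul_one]
  have hcc : ∀ x, x * c * c = x := fun x => by rw [mul_assoc, h.c_sq, mul_one]
  have hab : ∀ x, x * a * b = x * b * a := fun x => by rw [mul_assoc, h.comm, mul_assoc]
  unfold SqEdge
  simp only [h.adj_iff]
  constructor
  · rintro ⟨hk | hk | rfl, w, x, hw, hx, hg, hwg, hxk⟩
    · exact .inl hk
    · exact .inr hk
    · exfalso
      have h4 : ∀ u v, u = a ∨ u = b → v = a ∨ v = b → g * c * u * c * v = g → False := by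
        intro u v hu hv e
        refine h.four u v hu hv (mul_left_cancel (a := g) ?_)
        simpa [mul_assoc] using e
      have hac := h.a_ne_c
      have hbc := h.b_ne_c
      rcases hw with rfl | rfl | rfl
      · rcases hx with rfl | rfl | rfl
        · exact hxk (haa _)
        · rcases hg with e | e | e
          · rw [hab, haa, mul_assoc, left_eq_mul] at e
            exact hbc.symm (by rw [← mul_one c, ← h.b_sq, ← mul_assoc, e, one_mul])
          · rw [hbb, mul_assoc, left_eq_mul] at e
            exact hac.symm (by rw [← mul_one c, ← h.a_sq, ← mul_assoc, e, one_mul])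
          · exact hxk ((hcc _).symm.trans (congrArg (· * c) e.symm))
        · rcases hg with e | e | e
          · exact h4 a a (.inl rfl) (.inl rfl) e.symm
          · exact h4 a b (.inl rfl) (.inr rfl) e.symm
          · rw [hcc, mul_assoc, left_eq_mul] at e
            exact hac.symm (by rw [← mul_one c, ← h.a_sq, ← mul_assoc, e, one_mul])
      · rcases hx with rfl | rfl | rfl
        · rcases hg with e | e | e
          · rw [haa, mul_assoc, left_eq_mul] at e
            exact hbc.symm (by rw [← mul_one c, ← h.b_sq, ← mul_assoc, e, one_mul])
          · rw [← hab, hbb, mul_assoc, left_eq_mul] at e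
            exact hac.symm (by rw [← mul_one c, ← h.a_sq, ← mul_assoc, e, one_mul])
          · exact hxk ((hcc _).symm.trans (congrArg (· * c) e.symm))
        · exact hxk (hbb _)
        · rcases hg with e | e | e
          · exact h4 b a (.inr rfl) (.inl rfl) e.symm
          · exact h4 b b (.inr rfl) (.inr rfl) e.symm
          · rw [hcc, mul_assoc, left_eq_mul] at e
            exact hbc.symm (by rw [← mul_one c, ← h.b_sq, ← mul_assoc, e, one_mul])
      · exact hwg (hcc _)
  · have hne := h.a_ne_b
    rintro (rfl | rfl)
    · refine ⟨.inl rfl, g * a * b, g * b, .inr (.inl rfl), .inl ?_, .inr (.inl (hbb _).symm),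
        ?_, by simpa using hne.symm⟩
      · rw [hab, haa]
      · intro e
        exact hne (mul_left_cancel (a := g) (by rw [← hbb (g * a), e]))
    · refine ⟨.inr (.inl rfl), g * b * a, g * a, .inl rfl, .inr (.inl ?_), .inl (haa _).symm,
        ?_, by simpa using hne⟩
      · rw [← hab, hbb]
      · intro e
        exact hne (mul_left_cancel (a := g) (by rw [← haa (g * b), e])).symm

lemma nonSqEdge_iff (h : RigidTriple a b c) {g k : G} :
    NonSqEdge (mulCayley {a, b, c}) g k ↔ k = g * c := by
  rw [NonSqEdge, h.sqEdge_iff, h.adj_iff]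
  refine ⟨by tauto, ?_⟩
  rintro rfl
  simp [h.a_ne_c.symm, h.b_ne_c.symm]

lemma altEdge_iff (h : RigidTriple a b c) {g k : G} :
    AltEdge (mulCayley {a, b, c}) g k ↔ k = g * b := by
  simp only [AltEdge, h.sqEdge_iff, h.nonSqEdge_iff]
  constructor
  · rintro ⟨rfl | rfl, p, q, r, s, t, w, rfl, hq, rfl, hs, rfl, hw, e⟩
    · exfalso
      have h8 : ∀ u v w, u = a ∨ u = b → v = a ∨ v = b → w = a ∨ w = b →
          g = g * a * c * u * c * v * c * w * c → False := by
        intro u v w hu hv hw e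
        refine h.eight u v w hu hv hw (mul_left_cancel (a := g) ?_)
        simpa [mul_assoc] using e.symm
      rcases hq with rfl | rfl <;> rcases hs with rfl | rfl <;> rcases hw with rfl | rfl <;>
        exact h8 _ _ _ (by simp) (by simp) (by simp) e
    · rfl
  · rintro rfl
    refine ⟨.inr rfl, _, _, _, _, _, _, rfl, .inr rfl, rfl, .inr rfl, rfl, .inr rfl, ?_⟩
    simpa [mul_assoc] using h.bc_pow

section Rigidity

variable {G' : Type*} [Group G'] {a' b' c' : G'}

lemma iso_mul (h : RigidTriple a b c) (h' : RigidTriple a' b' c')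
    (φ : (mulCayley {a, b, c}) ≃g (mulCayley {a', b', c'})) (g : G) :
    φ (g * a) = φ g * a' ∧ φ (g * b) = φ g * b' ∧ φ (g * c) = φ g * c' := by
  have hb : φ (g * b) = φ g * b' := h'.altEdge_iff.1 ((h.altEdge_iff.2 rfl).map φ)
  refine ⟨?_, hb, h'.nonSqEdge_iff.1 ((h.nonSqEdge_iff.2 rfl).map φ)⟩
  refine (h'.sqEdge_iff.1 ((h.sqEdge_iff.2 (.inl rfl)).map φ)).resolve_right fun e => ?_
  rw [← hb] at e
  exact h.a_ne_b (mul_left_cancel (φ.injective e))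

/-- Induction along the generators, which are involutions. -/
lemma induction (h : RigidTriple a b c) {P : G → Prop} (one : P 1)
    (step : ∀ g, P g → P (g * a) ∧ P (g * b) ∧ P (g * c)) (g : G) : P g := by
  have hg : g ∈ Subgroup.closure {a, b, c} := h.closure_eq ▸ Subgroup.mem_top g
  have inv : ∀ s : G, s * s = 1 → s⁻¹ = s := fun s hs => inv_eq_of_mul_eq_one_left hs
  induction hg using Subgroup.closure_induction_right with
  | one => exact one
  | mul_right x hx y hy ih =>
    rcases hy with rfl | rfl | rfl
    exacts [(step _ ih).1, (step _ ih).2.1, (step _ ih).2.2]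
  | mul_inv_cancel x hx y hy ih =>
    rcases hy with rfl | rfl | rfl
    · rw [inv _ h.a_sq]; exact (step _ ih).1
    · rw [inv _ h.b_sq]; exact (step _ ih).2.1
    · rw [inv _ h.c_sq]; exact (step _ ih).2.2

/-- Isomorphic Cayley graphs of rigid triples come from an isomorphism of the marked groups. -/
lemma exists_mulEquiv (h : RigidTriple a b c) (h' : RigidTriple a' b' c')
    (φ : (mulCayley {a, b, c}) ≃g (mulCayley {a', b', c'})) :
    ∃ Φ : G ≃* G', Φ a = a' ∧ Φ b = b' ∧ Φ c = c' := by
  have key (g x : G) : (φ 1)⁻¹ * φ (g * x) = ((φ 1)⁻¹ * φ g) * ((φ 1)⁻¹ * φ x) := by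
    refine h.induction (P := fun x => (φ 1)⁻¹ * φ (g * x) =
      ((φ 1)⁻¹ * φ g) * ((φ 1)⁻¹ * φ x)) (by simp) (fun x hx => ?_) x
    simp only [← mul_assoc g x, (h.iso_mul h' φ _).1, (h.iso_mul h' φ _).2.1,
      (h.iso_mul h' φ _).2.2, ← mul_assoc]
    simp only [← mul_assoc] at hx
    simp [hx]
  refine ⟨MulEquiv.mk' (φ.toEquiv.trans (Equiv.mulLeft (φ 1)⁻¹)) key, ?_, ?_, ?_⟩
  · exact inv_mul_eq_iff_eq_mul.2 (by simpa using (h.iso_mul h' φ 1).1)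
  · exact inv_mul_eq_iff_eq_mul.2 (by simpa using (h.iso_mul h' φ 1).2.1)
  · exact inv_mul_eq_iff_eq_mul.2 (by simpa using (h.iso_mul h' φ 1).2.2)

lemma connected (h : RigidTriple a b c) : (mulCayley {a, b, c}).Connected := by
  refine (connected_iff_exists_forall_reachable _).2 ⟨1, h.induction (by rfl) fun g hg => ?_⟩
  exact ⟨hg.trans (h.adj_iff.2 (.inl rfl)).reachable,
    hg.trans (h.adj_iff.2 (.inr (.inl rfl))).reachable,
    hg.trans (h.adj_iff.2 (.inr (.inr rfl))).reachable⟩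

lemma dValent (h : RigidTriple a b c) : DValent (mulCayley {a, b, c}) 3 := by
  intro g
  have : (mulCayley {a, b, c}).neighborSet g = {g * a, g * b, g * c} := by
    ext k
    simp [h.adj_iff]
  rw [this, Set.ncard_eq_three]
  exact ⟨_, _, _, by simpa using h.a_ne_b, by simpa using h.a_ne_c, by simpa using h.b_ne_c, rfl⟩

lemma isGRR (h : RigidTriple a b c) : IsGRR (mulCayley {a, b, c}) := by
  intro u v
  refine ⟨⟨Equiv.mulLeft (v * u⁻¹), ?_⟩, by simp, fun φ hφ => ?_⟩
  · intro x y
    simp [h.adj_iff, mul_assoc]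
  · have key : ∀ x, φ (u * x) = v * x := by
      refine h.induction (by simpa using hφ) fun x hx => ?_
      simp only [← mul_assoc, (h.iso_mul h φ _).1, (h.iso_mul h φ _).2.1,
        (h.iso_mul h φ _).2.2, hx, and_self]
    ext x
    simpa [mul_assoc] using key (u⁻¹ * x)

end Rigidity

end RigidTriple

section DihedralLift

variable {M : Type*} [Group M] {n : ℕ} {A Y : M}

/-- The homomorphism `ZMod n → M` sending `1` to an element `Y` with `Y ^ n = 1`. -/
def zmodPow (hY : Y ^ n = 1) : ZMod n →+ Additive M :=
  ZMod.lift n ⟨zmultiplesHom (Additive M) (Additive.ofMul Y), by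
    simp [← ofMul_pow, hY]⟩

lemma zmodPow_intCast (hY : Y ^ n = 1) (k : ℤ) : (zmodPow hY k).toMul = Y ^ k := by
  simp [zmodPow]

lemma conj_zmodPow (hY : Y ^ n = 1) (hA : A * A = 1) (hAY : A * Y * A = Y⁻¹) (i : ZMod n) :
    A * (zmodPow hY i).toMul * A = (zmodPow hY (-i)).toMul := by
  obtain ⟨k, rfl⟩ := ZMod.intCast_surjective i
  have hA' : A⁻¹ = A := inv_eq_of_mul_eq_one_left hA
  rw [← Int.cast_neg, zmodPow_intCast, zmodPow_intCast]
  calc A * Y ^ k * A = (A * Y * A⁻¹) ^ k := by rw [conj_zpow, hA']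
    _ = Y ^ (-k) := by rw [hA', hAY, inv_zpow, zpow_neg]

/-- The homomorphism from a dihedral group determined by images of a rotation and a reflection. -/
def dihedralLift (hY : Y ^ n = 1) (hA : A * A = 1) (hAY : A * Y * A = Y⁻¹) :
    DihedralGroup n →* M :=
  MonoidHom.mk' (fun
    | .r i => (zmodPow hY i).toMul
    | .sr i => A * (zmodPow hY i).toMul) <| by
    have key (i) : (zmodPow hY i).toMul * A = A * (zmodPow hY (-i)).toMul := by
      rw [← conj_zmodPow hY hA hAY, ← mul_assoc, ← mul_assoc, hA, one_mul]
    rintro (i | i) (j | j)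
    · simp [DihedralGroup.r_mul_r]
    · rw [DihedralGroup.r_mul_sr]
      dsimp only
      rw [← mul_assoc, key, mul_assoc, ← toMul_add, ← map_add, neg_add_eq_sub]
    · simp [DihedralGroup.sr_mul_r, mul_assoc]
    · rw [DihedralGroup.sr_mul_sr]
      dsimp only
      rw [mul_assoc, ← mul_assoc _ A, key, ← mul_assoc, ← mul_assoc, hA, one_mul, ← toMul_add,
        ← map_add, neg_add_eq_sub]

lemma dihedralLift_r_one (hY : Y ^ n = 1) (hA : A * A = 1) (hAY : A * Y * A = Y⁻¹) :
    dihedralLift hY hA hAY (.r 1) = Y := by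
  change (zmodPow hY 1).toMul = Y
  simpa only [Int.cast_one, zpow_one] using zmodPow_intCast hY 1

lemma dihedralLift_sr_zero (hY : Y ^ n = 1) (hA : A * A = 1) (hAY : A * Y * A = Y⁻¹) :
    dihedralLift hY hA hAY (.sr 0) = A := by
  simp [dihedralLift]

end DihedralLift

/-- The central extension of the additive group `K × K` by `Z` with cocycle
`F (p * p' + T * p * q' + q * q')`. Here `K × K` stands for the ring `K[y]/(y² + T * y + 1)`, with
its involution `u ↦ u*` swapping `y` and `y⁻¹`, and the cocycle is `F` of the constant coefficient
of `u * v*`. -/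
@[ext] structure NormExt {K Z : Type*} [CommRing K] [AddCommGroup Z] (T : K) (F : K →+ Z) where
  /-- the constant coefficient of the image in `K × K` -/
  p : K
  /-- the coefficient of `y` of the image in `K × K` -/
  q : K
  /-- the central coordinate -/
  z : Z

namespace NormExt

variable {K Z : Type*} [CommRing K] [AddCommGroup Z] {T : K} {F : K →+ Z}

instance : Mul (NormExt T F) :=
  ⟨fun g h => ⟨g.p + h.p, g.q + h.q, g.z + h.z + F (g.p * h.p + T * g.p * h.q + g.q * h.q)⟩⟩

instance : One (NormExt T F) := ⟨⟨0, 0, 0⟩⟩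

instance : Inv (NormExt T F) :=
  ⟨fun g => ⟨-g.p, -g.q, -g.z + F (g.p * g.p + T * g.p * g.q + g.q * g.q)⟩⟩

@[simp] lemma mul_p (g h : NormExt T F) : (g * h).p = g.p + h.p := rfl
@[simp] lemma mul_q (g h : NormExt T F) : (g * h).q = g.q + h.q := rfl
@[simp] lemma mul_z (g h : NormExt T F) :
    (g * h).z = g.z + h.z + F (g.p * h.p + T * g.p * h.q + g.q * h.q) := rfl
@[simp] lemma one_p : (1 : NormExt T F).p = 0 := rfl
@[simp] lemma one_q : (1 : NormExt T F).q = 0 := rfl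
@[simp] lemma one_z : (1 : NormExt T F).z = 0 := rfl
@[simp] lemma inv_p (g : NormExt T F) : g⁻¹.p = -g.p := rfl
@[simp] lemma inv_q (g : NormExt T F) : g⁻¹.q = -g.q := rfl
@[simp] lemma inv_z (g : NormExt T F) :
    g⁻¹.z = -g.z + F (g.p * g.p + T * g.p * g.q + g.q * g.q) := rfl

instance : Group (NormExt T F) :=
  Group.ofLeftAxioms
    (by
      intro g h k
      ext
      · simp [add_assoc]
      · simp [add_assoc]
      · have e : ∀ x y u v : K, x + y = u + v → F x + F y = F u + F v := fun x y u v e => by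
          rw [← map_add, ← map_add, e]
        have := e (g.p * h.p + T * g.p * h.q + g.q * h.q)
          ((g.p + h.p) * k.p + T * (g.p + h.p) * k.q + (g.q + h.q) * k.q)
          (h.p * k.p + T * h.p * k.q + h.q * k.q)
          (g.p * (h.p + k.p) + T * g.p * (h.q + k.q) + g.q * (h.q + k.q)) (by ring)
        simp only [mul_z, mul_p, mul_q]
        rw [← sub_eq_zero] at this ⊢
        refine Eq.trans ?_ this
        abel)
    (by intro g; ext <;> simp)
    (by
      intro g
      ext
      · simp
      · simp
      · have : F (-g.p * g.p + T * -g.p * g.q + -g.q * g.q) =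
            -F (g.p * g.p + T * g.p * g.q + g.q * g.q) := by
          rw [← map_neg]; congr 1; ring
        simp only [mul_z, inv_p, inv_q, inv_z, one_z, this]
        abel)

variable (T F) in
/-- Forgetting the group structure. -/
def equivProd : NormExt T F ≃ K × K × Z where
  toFun g := (g.p, g.q, g.z)
  invFun x := ⟨x.1, x.2.1, x.2.2⟩

lemma card : Nat.card (NormExt T F) = Nat.card K * (Nat.card K * Nat.card Z) := by
  rw [Nat.card_congr (equivProd T F), Nat.card_prod, Nat.card_prod]

section CharTwo

variable [CharP K 2]

/-- Two arguments of `F` agreeing up to a multiple of `2` have the same image. -/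
lemma map_congr {x y : K} (w : K) (h : x = y + 2 * w) : F x = F y := by
  rw [h, CharTwo.two_eq_zero, zero_mul, add_zero]

variable (T F) in
/-- The automorphism lifting multiplication by `y`. -/
def rot : MulAut (NormExt T F) where
  toFun g := ⟨g.q, g.p + T * g.q, g.z⟩
  invFun g := ⟨g.q + T * g.p, g.p, g.z⟩
  left_inv g := by
    ext <;> simp [add_assoc, CharTwo.add_self_eq_zero]
  right_inv g := by
    ext <;> simp [add_assoc, CharTwo.add_self_eq_zero]
  map_mul' g h := by
    ext
    · simp
    · simp only [mul_p, mul_q]; ring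
    · simp only [mul_z, add_right_inj]
      exact map_congr (-(T * g.q * h.p + T ^ 2 * g.q * h.q)) (by ring)

@[simp] lemma rot_p (g : NormExt T F) : (rot T F g).p = g.q := rfl
@[simp] lemma rot_q (g : NormExt T F) : (rot T F g).q = g.p + T * g.q := rfl
@[simp] lemma rot_z (g : NormExt T F) : (rot T F g).z = g.z := rfl

/-- The underlying map of `refl`. -/
def reflFun (g : NormExt T F) : NormExt T F :=
  ⟨g.p + T * g.q, g.q, g.z + F (g.p * g.p + T * g.p * g.q + g.q * g.q)⟩

lemma reflFun_involutive : Function.Involutive (reflFun (T := T) (F := F)) := by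
  intro g
  ext
  · simp [reflFun, add_assoc, CharTwo.add_self_eq_zero]
  · rfl
  · simp only [reflFun, add_assoc, add_eq_left, ← map_add]
    rw [← map_zero F]
    exact map_congr (g.p * g.p + 2 * (T * g.p * g.q) + g.q * g.q + T ^ 2 * g.q ^ 2) (by ring)

variable (T F) in
/-- The automorphism lifting the involution swapping `y` and `y⁻¹`. -/
def refl : MulAut (NormExt T F) where
  toEquiv := reflFun_involutive.toPerm
  map_mul' g h := by
    ext
    · simp only [reflFun, Equiv.toFun_as_coe, Function.Involutive.coe_toPerm, mul_p, mul_q]; ring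
    · rfl
    · have e : ∀ x y u v w t : K, x + y = u + v + w + 2 * t →
          F x + F y = F u + F v + F w := fun x y u v w t e => by
        rw [← map_add, ← map_add, ← map_add, e, CharTwo.two_eq_zero, zero_mul, add_zero]
      have := e (g.p * h.p + T * g.p * h.q + g.q * h.q)
        ((g.p + h.p) * (g.p + h.p) + T * (g.p + h.p) * (g.q + h.q) + (g.q + h.q) * (g.q + h.q))
        (g.p * g.p + T * g.p * g.q + g.q * g.q) (h.p * h.p + T * h.p * h.q + h.q * h.q)
        ((g.p + T * g.q) * (h.p + T * h.q) + T * (g.p + T * g.q) * h.q + g.q * h.q)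
        (g.p * h.p + g.q * h.q - T ^ 2 * g.q * h.q) (by ring)
      simp only [reflFun, Equiv.toFun_as_coe, Function.Involutive.coe_toPerm, mul_p, mul_q, mul_z]
      rw [← sub_eq_zero] at this ⊢
      refine Eq.trans ?_ this
      abel

@[simp] lemma refl_p (g : NormExt T F) : (refl T F g).p = g.p + T * g.q := rfl
@[simp] lemma refl_q (g : NormExt T F) : (refl T F g).q = g.q := rfl
@[simp] lemma refl_z (g : NormExt T F) :
    (refl T F g).z = g.z + F (g.p * g.p + T * g.p * g.q + g.q * g.q) := rfl

lemma refl_mul_refl : refl T F * refl T F = 1 :=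
  MulEquiv.ext reflFun_involutive

lemma refl_mul_rot_mul_refl : refl T F * rot T F * refl T F = (rot T F)⁻¹ := by
  refine MulEquiv.ext fun g => ?_
  change _ = (⟨g.q + T * g.p, g.p, g.z⟩ : NormExt T F)
  ext
  · simp [add_assoc, CharTwo.add_self_eq_zero]
  · simp [add_assoc, CharTwo.add_self_eq_zero]
  · simp only [MulAut.mul_apply, rot_z, rot_p, rot_q, refl_p, refl_q, refl_z, add_assoc,
      add_eq_left, ← map_add]
    rw [← map_zero F]
    exact map_congr (3 * g.p * T * g.q + g.p ^ 2 + 3 * T ^ 2 * g.q ^ 2 + g.q ^ 2) (by ring)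

lemma rot_pow_two_pow {r : ℕ} (hT : T ^ 2 ^ r = 0) : rot T F ^ 2 ^ (r + 1) = 1 := by
  let N : Module.End K (K × K) :=
    { toFun := fun u => (u.1 + u.2, u.1 + T * u.2 + u.2)
      map_add' := fun u v => by ext <;> simp <;> ring
      map_smul' := fun k u => by ext <;> simp <;> ring }
  have hrot (g : NormExt T F) (k : ℕ) : ((rot T F ^ k) g).z = g.z ∧
      (((rot T F ^ k) g).p, ((rot T F ^ k) g).q) = ((1 + N) ^ k) (g.p, g.q) := by
    induction k with
    | zero => simp
    | succ k ih =>
      rw [pow_succ', pow_succ', MulAut.mul_apply, Module.End.mul_apply, ← ih.2]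
      refine ⟨ih.1, ?_⟩
      ext
      · simp [N, ← add_assoc, CharTwo.add_self_eq_zero]
      · simp only [rot_q, LinearMap.add_apply, Module.End.one_apply, LinearMap.coe_mk,
          AddHom.coe_mk, Prod.snd_add, N]
        linear_combination (-((rot T F ^ k) g).q) * (CharTwo.two_eq_zero : (2 : K) = 0)
  have two : (2 : Module.End K (K × K)) = 0 := by
    ext <;> simp [← one_add_one_eq_two, CharTwo.add_self_eq_zero]
  have hpow (k : ℕ) : (1 + N) ^ 2 ^ k = 1 + N ^ 2 ^ k := by
    induction k with
    | zero => simp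
    | succ k ih =>
      have : (1 + N ^ 2 ^ k) ^ 2 = 1 + 2 * N ^ 2 ^ k + (N ^ 2 ^ k) ^ 2 := by noncomm_ring
      rw [pow_succ, pow_mul, ih, this, two, zero_mul, add_zero, pow_mul]
  have hN : N ^ 2 = T • (1 + N) := by
    refine LinearMap.ext fun u => ?_
    ext
    · simp only [sq, N, Module.End.mul_apply, LinearMap.coe_mk, AddHom.coe_mk,
        LinearMap.smul_apply, LinearMap.add_apply, Module.End.one_apply, Prod.smul_fst,
        Prod.fst_add, smul_eq_mul]
      linear_combination (u.1 + u.2 - T * u.1) * (CharTwo.two_eq_zero : (2 : K) = 0)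
    · simp only [sq, N, Module.End.mul_apply, LinearMap.coe_mk, AddHom.coe_mk,
        LinearMap.smul_apply, LinearMap.add_apply, Module.End.one_apply, Prod.smul_snd,
        Prod.snd_add, smul_eq_mul]
      linear_combination (u.1 + u.2) * (CharTwo.two_eq_zero : (2 : K) = 0)
  have h1 : (1 + N) ^ 2 ^ (r + 1) = 1 := by
    rw [hpow, pow_succ', pow_mul, hN, smul_pow, hT, zero_smul, add_zero]
  refine MulEquiv.ext fun g => ?_
  have := hrot g (2 ^ (r + 1))
  rw [h1, Module.End.one_apply, Prod.mk.injEq] at this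
  exact NormExt.ext this.2.1 this.2.2 this.1

end CharTwo

end NormExt

namespace NormExt

variable {K Z : Type*} [CommRing K] [CharP K 2] [AddCommGroup Z] {T : K} {F F' : K →+ Z}

section Dihedral

variable {n : ℕ}

variable (T F n) in
/-- The dihedral group acting on `NormExt T F`. -/
abbrev dihedralAct (hn : rot T F ^ n = 1) : DihedralGroup n →* MulAut (NormExt T F) :=
  dihedralLift hn refl_mul_refl refl_mul_rot_mul_refl

variable (T F n) in
/-- The extension of `NormExt T F` by a dihedral group. -/
abbrev DihedralExt (hn : rot T F ^ n = 1) : Type _ :=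
  NormExt T F ⋊[dihedralAct T F n hn] DihedralGroup n

variable {hn : rot T F ^ n = 1} {hn' : rot T F' ^ n = 1}

open SemidirectProduct

variable (hn) in
/-- The first generator of `DihedralExt`, a reflection. -/
abbrev genA : DihedralExt T F n hn := inr (.sr 0)

variable (hn) in
/-- The second generator of `DihedralExt`, a lift of `1 ∈ K`. -/
abbrev genB : DihedralExt T F n hn := inl ⟨1, 0, 0⟩

variable (hn) in
/-- The third generator of `DihedralExt`, a reflection. -/
abbrev genC : DihedralExt T F n hn := inr (.sr 1)

lemma dihedralAct_sr_zero : dihedralAct T F n hn (.sr 0) = refl T F :=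
  dihedralLift_sr_zero _ _ _

lemma dihedralAct_r_one : dihedralAct T F n hn (.r 1) = rot T F :=
  dihedralLift_r_one _ _ _

lemma dihedralAct_sr_one : dihedralAct T F n hn (.sr 1) = refl T F * rot T F := by
  rw [← dihedralAct_sr_zero (hn := hn), ← dihedralAct_r_one (hn := hn), ← map_mul,
    DihedralGroup.sr_mul_r, zero_add]

lemma sr_ne_one (i : ZMod n) : (DihedralGroup.sr i : DihedralGroup n) ≠ 1 := nofun

lemma r_eq_one {i : ZMod n} : (DihedralGroup.r i : DihedralGroup n) = 1 ↔ i = 0 := by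
  rw [← DihedralGroup.r_zero, DihedralGroup.r.injEq]

lemma closure_gen_eq_top (hF : Function.Surjective fun q => F (T * q))
    (hT : ∀ S : AddSubgroup K, 1 ∈ S → (∀ x ∈ S, T * x ∈ S) → S = ⊤) :
    Subgroup.closure {genA hn, genB hn, genC hn} = ⊤ := by
  set H := Subgroup.closure {genA hn, genB hn, genC hn}
  have ha : genA hn ∈ H := Subgroup.subset_closure (by simp)
  have hb : genB hn ∈ H := Subgroup.subset_closure (by simp)
  have hc : genC hn ∈ H := Subgroup.subset_closure (by simp)
  have hr : (inr (.r 1) : DihedralExt T F n hn) ∈ H := by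
    have := H.mul_mem ha hc
    rwa [← map_mul, DihedralGroup.sr_mul_sr, sub_zero] at this
  have hD (d : DihedralGroup n) : (inr d : DihedralExt T F n hn) ∈ H := by
    have hrot (i : ZMod n) : (inr (.r i) : DihedralExt T F n hn) ∈ H := by
      obtain ⟨k, rfl⟩ := ZMod.intCast_surjective i
      rw [← DihedralGroup.r_one_zpow, map_zpow]
      exact H.zpow_mem hr k
    rcases d with i | i
    · exact hrot i
    · have := H.mul_mem ha (hrot i)
      rwa [← map_mul, DihedralGroup.sr_mul_r, zero_add] at this
  have hY (g : NormExt T F) (hg : inl g ∈ H) : inl (rot T F g) ∈ H := by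
    rw [← dihedralAct_r_one (hn := hn), inl_aut]
    exact H.mul_mem (H.mul_mem (hD _) hg) (hD _)
  have hmul {g k : NormExt T F} (hg : inl g ∈ H) (hk : inl k ∈ H) : inl (g * k) ∈ H := by
    rw [map_mul]
    exact H.mul_mem hg hk
  have forget {g : NormExt T F} (hg : inl g ∈ H) :
      ∃ z, (inl ⟨g.p, g.q, z⟩ : DihedralExt T F n hn) ∈ H := ⟨g.z, hg⟩
  let S : AddSubgroup K :=
    { carrier := {p | ∃ z, (inl ⟨p, 0, z⟩ : DihedralExt T F n hn) ∈ H}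
      zero_mem' := ⟨0, H.one_mem⟩
      add_mem' := by
        rintro p p' ⟨z, hz⟩ ⟨z', hz'⟩
        simpa using forget (hmul hz hz')
      neg_mem' := by
        rintro p ⟨z, hz⟩
        exact ⟨z, by rwa [CharTwo.neg_eq]⟩ }
  have hS : S = ⊤ := by
    refine hT S ⟨0, hb⟩ ?_
    rintro p ⟨z, hz⟩
    change ∃ z, (inl ⟨T * p, 0, z⟩ : DihedralExt T F n hn) ∈ H
    have hA : inl (refl T F (rot T F ⟨p, 0, z⟩)) ∈ H := by
      rw [← dihedralAct_sr_zero (hn := hn), inl_aut]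
      exact H.mul_mem (H.mul_mem (hD _) (hY _ hz)) (hD _)
    simpa [CharTwo.add_self_eq_zero] using forget (hmul hA (hY _ hz))
  have hpq (p q : K) : ∃ z, (inl ⟨p, q, z⟩ : DihedralExt T F n hn) ∈ H := by
    obtain ⟨z, hz⟩ : p ∈ S := hS ▸ AddSubgroup.mem_top p
    obtain ⟨z', hz'⟩ : q ∈ S := hS ▸ AddSubgroup.mem_top q
    simpa using forget (hmul hz (hY _ hz'))
  have hcen (z : Z) : (inl ⟨0, 0, z⟩ : DihedralExt T F n hn) ∈ H := by
    obtain ⟨q, rfl⟩ := hF z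
    obtain ⟨z, hz⟩ := hpq 0 q
    have := H.mul_mem (hmul hb hz) (H.inv_mem (hmul hz hb))
    rw [← map_inv, ← map_mul] at this
    convert this using 2
    rw [eq_mul_inv_iff_mul_eq]
    ext <;> simp [add_comm]
  rw [eq_top_iff]
  rintro ⟨g, d⟩ -
  obtain ⟨z, hz⟩ := hpq g.p g.q
  have := H.mul_mem (H.mul_mem (hcen (g.z - z)) hz) (hD d)
  rw [← map_mul] at this
  convert this using 1
  rw [mk_eq_inl_mul_inr]
  congr 2
  ext <;> simp

theorem rigidTriple_gen (hF : Function.Surjective fun q => F (T * q)) (hF1 : F 1 = 0)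
    (hFT : F T = 0) (hT0 : T ≠ 0) (h4 : (4 : ZMod n) ≠ 0)
    (hT : ∀ S : AddSubgroup K, 1 ∈ S → (∀ x ∈ S, T * x ∈ S) → S = ⊤) :
    RigidTriple (genA hn) (genB hn) (genC hn) where
  a_sq := by rw [← map_mul, DihedralGroup.sr_mul_self, map_one]
  b_sq := by
    rw [← map_mul, map_eq_one_iff _ inl_injective]
    ext <;> simp [hF1, CharTwo.add_self_eq_zero]
  c_sq := by rw [← map_mul, DihedralGroup.sr_mul_self, map_one]
  comm := by
    ext <;> simp [dihedralAct_sr_zero, hF1]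
  bc_pow := by
    ext
    · simp [dihedralAct_sr_one]
      linear_combination (1 + T) * (CharTwo.two_eq_zero : (2 : K) = 0)
    · simp [dihedralAct_sr_one, CharTwo.add_self_eq_zero]
    · simp [dihedralAct_sr_one, add_right_comm 1 T 1, CharTwo.add_self_eq_zero, hF1, hFT]
    · simp
  closure_eq := closure_gen_eq_top hF hT
  a_ne_one e := by simpa [sr_ne_one] using congrArg (·.right) e
  b_ne_one e := by
    have := nontrivial_of_ne T 0 hT0
    exact one_ne_zero (congrArg (·.left.p) e)
  c_ne_one e := by simpa [sr_ne_one] using congrArg (·.right) e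
  a_ne_b e := by simpa [sr_ne_one] using congrArg (·.right) e
  a_ne_c e := by
    have : (0 : ZMod n) = 1 := by simpa using congrArg (·.right) e
    exact h4 (by linear_combination -4 * this)
  b_ne_c e := by simpa [sr_ne_one] using congrArg (·.right) e.symm
  four := by
    have := nontrivial_of_ne T 0 hT0
    rintro u v (rfl | rfl) (rfl | rfl) e
    · have : -1 + -1 = (0 : ZMod n) := by
        simpa [DihedralGroup.sr_mul_sr, r_eq_one] using congrArg (·.right) e
      exact h4 (by linear_combination -2 * this)
    · simpa [DihedralGroup.sr_mul_sr, sr_ne_one] using congrArg (·.right) e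
    · simpa [DihedralGroup.sr_mul_sr, sr_ne_one] using congrArg (·.right) e
    · simpa [dihedralAct_sr_one] using congrArg (·.left.q) e
  eight := by
    have := nontrivial_of_ne T 0 hT0
    rintro u v w (rfl | rfl) (rfl | rfl) (rfl | rfl) e
    · have : (1 : ZMod n) - (-1 + -1 - 1) = 0 := by
        simpa [DihedralGroup.sr_mul_sr, r_eq_one] using congrArg (·.right) e
      exact h4 (by linear_combination this)
    · simpa [DihedralGroup.sr_mul_sr, sr_ne_one] using congrArg (·.right) e
    · simpa [DihedralGroup.sr_mul_sr, sr_ne_one] using congrArg (·.right) e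
    · have : (1 : ZMod n) + 1 = 0 := by
        simpa [DihedralGroup.sr_mul_sr, r_eq_one] using congrArg (·.right) e
      exact h4 (by linear_combination 2 * this)
    · simpa [DihedralGroup.sr_mul_sr, sr_ne_one] using congrArg (·.right) e
    · exact hT0 (by simpa [dihedralAct_sr_one, dihedralAct_sr_zero, dihedralAct_r_one]
        using congrArg (·.left.p) e)
    · have : (1 : ZMod n) + 1 = 0 := by
        simpa [DihedralGroup.sr_mul_sr, r_eq_one] using congrArg (·.right) e
      exact h4 (by linear_combination 2 * this)
    · simpa [DihedralGroup.sr_mul_sr, sr_ne_one] using congrArg (·.right) e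

/-- The kernel of `F` on multiples of `T` is determined by the marked group. -/
theorem map_eq_zero_of_mulEquiv [NeZero n]
    (rigid : RigidTriple (genA hn) (genB hn) (genC hn))
    (Φ : DihedralExt T F n hn ≃* DihedralExt T F' n hn') (ha : Φ (genA hn) = genA hn')
    (hb : Φ (genB hn) = genB hn') (hc : Φ (genC hn) = genC hn') (q : K) (hq : F (T * q) = 0) :
    F' (T * q) = 0 := by
  have hact (d : DihedralGroup n) (g : NormExt T F) (g' : NormExt T F')
      (hg : g'.p = g.p ∧ g'.q = g.q) :
      (dihedralAct T F' n hn' d g').p = (dihedralAct T F n hn d g).p ∧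
      (dihedralAct T F' n hn' d g').q = (dihedralAct T F n hn d g).q := by
    have hrot (k : ℕ) : ∀ (g : NormExt T F) (g' : NormExt T F'), g'.p = g.p ∧ g'.q = g.q →
        (dihedralAct T F' n hn' (.r k) g').p = (dihedralAct T F n hn (.r k) g).p ∧
        (dihedralAct T F' n hn' (.r k) g').q = (dihedralAct T F n hn (.r k) g).q := by
      induction k with
      | zero =>
        intro g g' hg
        simpa only [Nat.cast_zero, DihedralGroup.r_zero, map_one, MulAut.one_apply] using hg
      | succ k ih =>
        intro g g' hg
        rw [Nat.cast_succ, ← DihedralGroup.r_mul_r, map_mul, map_mul, dihedralAct_r_one,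
          dihedralAct_r_one]
        exact ih _ _ (by simp [hg])
    rcases d with i | i
    · obtain ⟨k, rfl⟩ := ZMod.natCast_zmod_surjective i
      exact hrot k g g' hg
    · obtain ⟨k, rfl⟩ := ZMod.natCast_zmod_surjective i
      rw [← zero_add (k : ZMod n), ← DihedralGroup.sr_mul_r, map_mul, map_mul,
        dihedralAct_sr_zero, dihedralAct_sr_zero]
      simp [hrot k g g' hg]
  have hΦ (g : DihedralExt T F n hn) : (Φ g).right = g.right ∧
      ((Φ g).left.p = g.left.p ∧ (Φ g).left.q = g.left.q) := by
    refine rigid.induction (P := fun g => (Φ g).right = g.right ∧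
      ((Φ g).left.p = g.left.p ∧ (Φ g).left.q = g.left.q)) (by simp) (fun g ih => ?_) g
    obtain ⟨ih₁, ih₂, ih₃⟩ := ih
    have hb' := hact g.right ⟨1, 0, 0⟩ ⟨1, 0, 0⟩ ⟨rfl, rfl⟩
    simp [map_mul, ha, hb, hc, ih₁, ih₂, ih₃, hb']
  have hcomm : (inl ⟨0, q, 0⟩ : DihedralExt T F n hn) * genB hn =
      genB hn * inl ⟨0, q, 0⟩ := by
    rw [← map_mul, ← map_mul]
    congr 1
    ext <;> simp [hq]
  have := congrArg (·.left.z) (congrArg Φ hcomm)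
  have h0 := hΦ (inl ⟨0, q, 0⟩)
  simpa [hb, h0] using this

end Dihedral

end NormExt

section Family

open Polynomial

/-- The ring of polynomials over `ZMod 2` truncated at degree `h`. -/
abbrev TruncPoly (h : ℕ) : Type := AdjoinRoot (X ^ h : (ZMod 2)[X])

namespace TruncPoly

variable {h : ℕ}

/-- The class of `X`. -/
noncomputable abbrev T : TruncPoly h := AdjoinRoot.root (X ^ h)

lemma T_pow : (T : TruncPoly h) ^ h = 0 := by
  simpa using AdjoinRoot.eval₂_root (X ^ h : (ZMod 2)[X])

variable (h) in
/-- The basis of powers of `X`. -/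
noncomputable def basis : Module.Basis (Fin h) (ZMod 2) (TruncPoly h) :=
  (AdjoinRoot.powerBasis' (monic_X_pow h)).basis.reindex (finCongr (natDegree_X_pow h))

lemma basis_apply (i : Fin h) : basis h i = T ^ (i : ℕ) := by
  simp [basis]
  rfl

lemma card : Nat.card (TruncPoly h) = 2 ^ h := by
  rw [Nat.card_congr (basis h).equivFun.toEquiv]
  simp

instance [NeZero h] : Nontrivial (TruncPoly h) :=
  AdjoinRoot.nontrivial _ (by simp [NeZero.ne h])

instance [NeZero h] : CharP (TruncPoly h) 2 :=
  charP_of_injective_algebraMap (algebraMap (ZMod 2) (TruncPoly h)).injective 2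

lemma eq_top (S : AddSubgroup (TruncPoly h)) (h1 : 1 ∈ S)
    (hT : ∀ x ∈ S, T * x ∈ S) : S = ⊤ := by
  have hpow (i : ℕ) : T ^ i ∈ S := by
    induction i with
    | zero => simpa using h1
    | succ i ih => simpa [pow_succ'] using hT _ ih
  rw [eq_top_iff]
  intro x _
  rw [← (basis h).sum_repr x]
  refine S.sum_mem fun i _ => ?_
  rw [basis_apply, ← ZMod.natCast_zmod_val ((basis h).repr x i), Nat.cast_smul_eq_nsmul]
  exact S.nsmul_mem (hpow _) _

variable {j l : ℕ}

variable (j l) in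
/-- The basis of powers of `X`, divided into three blocks. -/
noncomputable def blockBasis :
    Module.Basis ((Fin 2 ⊕ Fin j) ⊕ Fin l) (ZMod 2) (TruncPoly (2 + j + l)) :=
  (basis _).reindex (finSumFinEquiv.symm.trans (finSumFinEquiv.symm.sumCongr (.refl _)))

/-- The linear map killing `1` and `X`, sending the next `j` powers of `X` to the standard basis
and the last `l` powers of `X` to the given vectors. -/
noncomputable def toVec (M : Fin l → Fin j → ZMod 2) :
    TruncPoly (2 + j + l) →ₗ[ZMod 2] (Fin j → ZMod 2) :=
  (blockBasis j l).constr (ZMod 2) (Sum.elim (Sum.elim 0 fun i => Pi.single i 1) M)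

variable (M : Fin l → Fin j → ZMod 2)

lemma toVec_pow_fst (i : Fin 2) : toVec M (T ^ (i : ℕ)) = 0 := by
  have : T ^ (i : ℕ) = blockBasis j l (.inl (.inl i)) := by simp [blockBasis, basis_apply]
  rw [this, toVec, Module.Basis.constr_basis]
  rfl

lemma toVec_pow_snd (i : Fin j) : toVec M (T ^ (2 + i : ℕ)) = Pi.single i 1 := by
  have : T ^ (2 + i : ℕ) = blockBasis j l (.inl (.inr i)) := by simp [blockBasis, basis_apply]
  rw [this, toVec, Module.Basis.constr_basis]
  rfl

lemma toVec_pow_thd (i : Fin l) : toVec M (T ^ (2 + j + i : ℕ)) = M i := by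
  have : T ^ (2 + j + i : ℕ) = blockBasis j l (.inr i) := by simp [blockBasis, basis_apply]
  rw [this, toVec, Module.Basis.constr_basis]
  rfl

/-- A section of `toVec M`, with image in the ideal generated by `X ^ 2`. -/
lemma toVec_section (z : Fin j → ZMod 2) :
    toVec M (T * ∑ i, z i • T ^ (1 + i : ℕ)) = z := by
  have (i : Fin j) : (T : TruncPoly (2 + j + l)) * (z i • T ^ (1 + i : ℕ)) =
      z i • T ^ (2 + i : ℕ) := by
    rw [mul_smul_comm, ← pow_succ']
    congr 2
    omega
  simp only [Finset.mul_sum, this, map_sum, map_smul, toVec_pow_snd]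
  simp [← Pi.single_smul, Finset.univ_sum_single]

lemma eq_of_toVec_eq_zero {M M' : Fin l → Fin j → ZMod 2}
    (h : ∀ q, toVec M (T * q) = 0 → toVec M' (T * q) = 0) : M = M' := by
  funext i
  have hi : (2 + j + i : ℕ) = (1 + j + i) + 1 := by omega
  have key (M' : Fin l → Fin j → ZMod 2) :
      toVec M' (T * (T ^ (1 + j + i : ℕ) - ∑ s, M i s • T ^ (1 + s : ℕ))) = M' i - M i := by
    rw [mul_sub, map_sub, toVec_section, ← pow_succ', ← hi, toVec_pow_thd]
  exact (sub_eq_zero.1 ((key M').symm.trans (h _ ((key M).trans (sub_self _))))).symm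

open NormExt

variable {r : ℕ}

lemma rot_T_pow (hr : 2 + j + l ≤ 2 ^ r) :
    rot T (toVec M).toAddMonoidHom ^ 2 ^ (r + 1) = 1 :=
  rot_pow_two_pow (pow_eq_zero_of_le hr T_pow)

lemma rigidTriple (hr : 2 + j + l ≤ 2 ^ r) (hr2 : 2 ≤ r) :
    RigidTriple (genA (rot_T_pow M hr)) (genB (rot_T_pow M hr))
      (genC (rot_T_pow M hr)) := by
  refine rigidTriple_gen (fun z => ⟨_, toVec_section M z⟩) (by simpa using toVec_pow_fst M 0)
    (by simpa using toVec_pow_fst M 1) ?_ ?_ eq_top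
  · have := (basis (2 + j + l)).ne_zero ⟨1, by omega⟩
    simpa [basis_apply] using this
  · intro h
    replace h := (ZMod.natCast_eq_zero_iff 4 _).1 h
    have := Nat.pow_le_pow_right (n := 2) two_pos hr2
    have := Nat.le_of_dvd (by norm_num) h
    omega

lemma card_dihedralExt (hr : 2 + j + l ≤ 2 ^ r) :
    Nat.card (DihedralExt T (toVec M).toAddMonoidHom (2 ^ (r + 1)) (rot_T_pow M hr)) =
      2 ^ (3 * j + 2 * l + r + 6) := by
  rw [SemidirectProduct.card, NormExt.card, DihedralGroup.nat_card, card]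
  simp only [Nat.card_eq_fintype_card, Fintype.card_fun, ZMod.card, Fintype.card_fin]
  ring

end TruncPoly

end Family

lemma natCard_le_numIsoClasses {ι : Type*} {P : GSig → Prop} {N : ℕ} (hP : ∀ x, P x → x.1 = N)
    (f : ι → GSig) (hf : ∀ i, P (f i)) (hinj : ∀ i i', Nonempty ((f i).2 ≃g (f i').2) → i = i') :
    Nat.card ι ≤ numIsoClasses P := by
  have : Finite {x : GSig // P x} := by
    refine Set.Finite.subset (Set.finite_range (Sigma.mk N)) ?_
    rintro ⟨n, Γ⟩ h
    obtain rfl : n = N := hP _ h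
    exact ⟨Γ, rfl⟩
  refine Nat.card_le_card_of_injective
    (fun i => (Quotient.mk (graphSetoid P) ⟨f i, hf i⟩)) fun i i' h => ?_
  exact hinj i i' (Quotient.exact h)

theorem two_pow_le_numIsoClasses {j l r : ℕ} (hr : 2 + j + l ≤ 2 ^ r) (hr2 : 2 ≤ r) :
    2 ^ (j * l) ≤ numIsoClasses (fun x => x.1 = 2 ^ (3 * j + 2 * l + r + 6) ∧ x.2.Connected ∧
      DValent x.2 3 ∧ IsGRR x.2) := by
  let G (M : Fin l → Fin j → ZMod 2) := NormExt.DihedralExt _ _ _ (TruncPoly.rot_T_pow M hr)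
  have rigid (M : Fin l → Fin j → ZMod 2) := TruncPoly.rigidTriple M hr hr2
  let Γ (M : Fin l → Fin j → ZMod 2) : SimpleGraph (G M) :=
    mulCayley {NormExt.genA _, NormExt.genB _, NormExt.genC _}
  let e (M : Fin l → Fin j → ZMod 2) : G M ≃ Fin (2 ^ (3 * j + 2 * l + r + 6)) :=
    have : Finite (G M) := Nat.finite_of_card_ne_zero (by
      rw [TruncPoly.card_dihedralExt M hr]; positivity)
    Finite.equivFinOfCardEq (TruncPoly.card_dihedralExt M hr)
  let φ (M : Fin l → Fin j → ZMod 2) : Γ M ≃g (Γ M).map (e M).toEmbedding := .map (e M) (Γ M)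
  calc 2 ^ (j * l) = Nat.card (Fin l → Fin j → ZMod 2) := by simp [pow_mul]
    _ ≤ _ := natCard_le_numIsoClasses (fun x hx => hx.1) (fun M => ⟨_, (Γ M).map (e M).toEmbedding⟩)
      (fun M => ⟨rfl, (φ M).connected_iff.1 (rigid M).connected, (rigid M).dValent.of_iso (φ M),
        (rigid M).isGRR.of_iso (φ M)⟩) ?_
  rintro M M' ⟨ψ⟩
  obtain ⟨Φ, ha, hb, hc⟩ :=
    (rigid M).exists_mulEquiv (rigid M') (((φ M).trans ψ).trans (φ M').symm)
  exact TruncPoly.eq_of_toVec_eq_zero (NormExt.map_eq_zero_of_mulEquiv (rigid M) Φ ha hb hc)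

lemma exists_exponents {ε : ℝ} (hε : 0 < ε) : ∃ m₀ : ℕ, ∀ m, m₀ ≤ m → ∃ j l r : ℕ,
    3 * j + 2 * l + r + 6 = m ∧ 2 + j + l ≤ 2 ^ r ∧ 2 ≤ r ∧
      (1 / 24 - ε) * (m : ℝ) ^ 2 ≤ ((j * l : ℕ) : ℝ) := by
  obtain ⟨k₀, hk₀⟩ := exists_nat_ge (1 / (6 * ε))
  refine ⟨(k₀ + 18) ^ 2, fun m hm => ?_⟩
  set r := Nat.sqrt m with hr
  have h₁ : k₀ + 18 ≤ r := Nat.le_sqrt'.2 hm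
  have h₂ : r ^ 2 ≤ m := Nat.sqrt_le' m
  have h₃ : m < (r + 1) ^ 2 := Nat.lt_succ_sqrt' m
  have h₄ : (r + 1) ^ 2 ≤ 2 ^ r := by
    have (k : ℕ) (hk : 6 ≤ k) : (k + 1) ^ 2 ≤ 2 ^ k := by
      induction k, hk using Nat.le_induction with
      | base => norm_num
      | succ k hk ih => rw [pow_succ 2]; nlinarith
    exact this r (by omega)
  have h₅ : r + 18 ≤ m := by nlinarith
  obtain ⟨s, hs⟩ : ∃ s, m = s + r + 6 := ⟨m - (r + 6), by omega⟩
  refine ⟨2 * (s / 12) + s % 2, (s - 3 * (2 * (s / 12) + s % 2)) / 2, r, by omega, by omega,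
    by omega, ?_⟩
  generalize hj : 2 * (s / 12) + s % 2 = j
  generalize hl : (s - 3 * j) / 2 = l
  have hj' : (s : ℝ) ≤ 6 * j + 12 := by norm_cast; omega
  have hl' : (s : ℝ) ≤ 4 * l + 8 := by norm_cast; omega
  have hm' : (m : ℝ) = s + r + 6 := by rw [hs]; norm_cast
  have hεr : (r : ℝ) + 18 ≤ 12 * ε * m := by
    have hr₁ : (k₀ : ℝ) + 18 ≤ r := by exact_mod_cast h₁
    have hr₂ : (r : ℝ) ^ 2 ≤ m := by exact_mod_cast h₂
    rw [div_le_iff₀ (by positivity)] at hk₀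
    have hεk : 1 ≤ r * (6 * ε) := hk₀.trans (by gcongr; linarith)
    calc (r : ℝ) + 18 ≤ 2 * r := by linarith
      _ ≤ 2 * r * (r * (6 * ε)) := le_mul_of_one_le_right (by positivity) hεk
      _ = 12 * ε * r ^ 2 := by ring
      _ ≤ 12 * ε * m := by gcongr
  have hs' : (12 : ℝ) ≤ s := by norm_cast; omega
  have hjl : ((s : ℝ) - 12) * (s - 8) ≤ 24 * (j * l) := by
    have := mul_le_mul (sub_le_iff_le_add.2 hj') (sub_le_iff_le_add.2 hl') (by linarith)
      (by positivity)
    linarith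
  have hm₂ : (m : ℝ) * (r + 18) ≤ m * (12 * ε * m) := by gcongr
  push_cast
  nlinarith

/-- For every `ε > 0`, for all sufficiently large `m`, the number of isomorphism classes of
connected 3-valent GRRs of order `2^m` is at least `2^((1/24 − ε)·m²)`. -/
theorem grr3_count_order_two_pow_lower_bound (ε : ℝ) (hε : 0 < ε) :
    ∃ m₀ : ℕ, ∀ m : ℕ, m₀ ≤ m →
      2 ^ ((1 / 24 - ε) * (m : ℝ) ^ 2) ≤
        (numIsoClasses
          (fun x => x.1 = 2 ^ m ∧ x.2.Connected ∧ DValent x.2 3 ∧ IsGRR x.2) : ℝ) := by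
  obtain ⟨m₀, hm₀⟩ := exists_exponents hε
  refine ⟨m₀, fun m hm => ?_⟩
  obtain ⟨j, l, r, rfl, hr, hr2, hjl⟩ := hm₀ m hm
  calc (2 : ℝ) ^ ((1 / 24 - ε) * ((3 * j + 2 * l + r + 6 : ℕ) : ℝ) ^ 2)
      ≤ 2 ^ ((j * l : ℕ) : ℝ) := Real.rpow_le_rpow_of_exponent_le one_le_two hjl
    _ = ((2 ^ (j * l) : ℕ) : ℝ) := by rw [Real.rpow_natCast]; norm_cast
    _ ≤ _ := Nat.cast_le.2 (two_pow_le_numIsoClasses hr hr2)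
end
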